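/- Let F be an algebraically closed field of characteristic ≠ 2, q a nondegenerate quadratic form on V, and suppose dim V ≡ 0, 1, or 3 (mod 4). Then every element t of Spin(V,q) can be written t = τ₁·τ₂ with τ₁, τ₂ ∈ Spin(V,q) and τ₁², τ₂² ∈ {1, −1}. Moreover, for any dimension of V, every real semisimple element t of Spin(V,q) admits such a decomposition t = τ₁·τ₂ with τ₁, τ₂ ∈ Spin(V,q), τ₁² = τ₂², and τ₁² ∈ {1, −1}. -/

import Mathlib

open CliffordAlgebra

/-- An element of the Spin group: a unit of the Clifford algebra lying in the Clifford
(Lipschitz) group, in the even part, with spinor norm `N(u) = reverse(u)·u = 1`. -/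
def IsSpinElt {F V : Type*} [Field F] [AddCommGroup V] [Module F V]
    (Q : QuadraticForm F V) (x : (CliffordAlgebra Q)ˣ) : Prop :=
  x ∈ lipschitzGroup Q ∧ (x : CliffordAlgebra Q) ∈ evenOdd Q 0 ∧
    reverse (x : CliffordAlgebra Q) * (x : CliffordAlgebra Q) = 1

namespace Stmt15
open Module

section LA
variable {F : Type*} [Field F] {V : Type*} [AddCommGroup V] [Module F V]

/-- `W = P + N` orthogonally, `X` swaps `P` and `N`, and `Y` preserves them. -/
def PN (B : LinearMap.BilinForm F V) (X Y : V →ₗ[F] V) (W P N : Submodule F V) : Prop :=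
  P ⊔ N = W ∧ (∀ p ∈ P, ∀ n ∈ N, B p n = 0) ∧
    (∀ p ∈ P, X p ∈ N ∧ Y p ∈ P) ∧ (∀ n ∈ N, X n ∈ P ∧ Y n ∈ N)

/-- Either a balanced decomposition exists, or decompositions of both parities exist. -/
def GoodOn (B : LinearMap.BilinForm F V) (X Y : V →ₗ[F] V) (W : Submodule F V) : Prop :=
  (∃ P N, PN B X Y W P N ∧ finrank F P = finrank F N) ∨
  ((∃ P N, PN B X Y W P N ∧ Even (finrank F N)) ∧ (∃ P N, PN B X Y W P N ∧ Odd (finrank F N)))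

theorem PN.symm {B : LinearMap.BilinForm F V} {X Y : V →ₗ[F] V} {W P N : Submodule F V}
    (hs : ∀ x y, B x y = B y x) (h : PN B X Y W P N) : PN B X Y W N P := by
  obtain ⟨h1, h2, h3, h4⟩ := h
  exact ⟨by rw [sup_comm, h1], fun p hp n hn => by rw [hs, h2 n hn p hp], h4, h3⟩

theorem PN.sup {B : LinearMap.BilinForm F V} {X Y : V →ₗ[F] V} {W P N W' P' N' : Submodule F V}
    (hs : ∀ x y, B x y = B y x) (ho : ∀ x ∈ W, ∀ y ∈ W', B x y = 0)
    (h : PN B X Y W P N) (h' : PN B X Y W' P' N') :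
    PN B X Y (W ⊔ W') (P ⊔ P') (N ⊔ N') := by
  obtain ⟨h1, h2, h3, h4⟩ := h
  obtain ⟨h1', h2', h3', h4'⟩ := h'
  have hP : P ≤ W := h1 ▸ le_sup_left
  have hN : N ≤ W := h1 ▸ le_sup_right
  have hP' : P' ≤ W' := h1' ▸ le_sup_left
  have hN' : N' ≤ W' := h1' ▸ le_sup_right
  refine ⟨by rw [sup_sup_sup_comm, h1, h1'], ?_, ?_, ?_⟩
  · intro p hp n hn
    obtain ⟨a, ha, b, hb, rfl⟩ := Submodule.mem_sup.1 hp
    obtain ⟨c, hc, d, hd, rfl⟩ := Submodule.mem_sup.1 hn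
    have e1 := h2 a ha c hc
    have e2 := h2' b hb d hd
    have e3 := ho a (hP ha) d (hN' hd)
    have e4 := ho c (hN hc) b (hP' hb)
    rw [hs] at e4
    simp [e1, e2, e3, e4]
  · intro p hp
    obtain ⟨a, ha, b, hb, rfl⟩ := Submodule.mem_sup.1 hp
    rw [map_add, map_add]
    exact ⟨Submodule.add_mem_sup (h3 a ha).1 (h3' b hb).1,
      Submodule.add_mem_sup (h3 a ha).2 (h3' b hb).2⟩
  · intro p hp
    obtain ⟨a, ha, b, hb, rfl⟩ := Submodule.mem_sup.1 hp
    rw [map_add, map_add]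
    exact ⟨Submodule.add_mem_sup (h4 a ha).1 (h4' b hb).1,
      Submodule.add_mem_sup (h4 a ha).2 (h4' b hb).2⟩

theorem finrank_sup_of_disj [FiniteDimensional F V] {P P' : Submodule F V}
    (h : Disjoint P P') : finrank F (P ⊔ P' : Submodule F V) = finrank F P + finrank F P' := by
  have := Submodule.finrank_sup_add_finrank_inf_eq P P'
  rw [h.eq_bot, finrank_bot] at this
  omega

theorem GoodOn.sup [FiniteDimensional F V] {B : LinearMap.BilinForm F V} {X Y : V →ₗ[F] V}
    {W W' : Submodule F V}
    (hs : ∀ x y, B x y = B y x) (ho : ∀ x ∈ W, ∀ y ∈ W', B x y = 0) (hd : Disjoint W W')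
    (h : GoodOn B X Y W) (h' : GoodOn B X Y W') : GoodOn B X Y (W ⊔ W') := by
  have key : ∀ P N P' N', PN B X Y W P N → PN B X Y W' P' N' →
      finrank F (P ⊔ P' : Submodule F V) = finrank F P + finrank F P' ∧
      finrank F (N ⊔ N' : Submodule F V) = finrank F N + finrank F N' := by
    intro P N P' N' h h'
    refine ⟨finrank_sup_of_disj (hd.mono ?_ ?_), finrank_sup_of_disj (hd.mono ?_ ?_)⟩
    · exact h.1 ▸ le_sup_left
    · exact h'.1 ▸ le_sup_left
    · exact h.1 ▸ le_sup_right
    · exact h'.1 ▸ le_sup_right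
  rcases h with ⟨P, N, h, e⟩ | ⟨⟨P, N, h, e⟩, ⟨P1, N1, h1, e1⟩⟩ <;>
  rcases h' with ⟨P', N', h', e'⟩ | ⟨⟨P', N', h', e'⟩, ⟨P1', N1', h1', e1'⟩⟩
  · left
    refine ⟨_, _, h.sup hs ho h', ?_⟩
    rw [(key _ _ _ _ h h').1, (key _ _ _ _ h h').2, e, e']
  · right
    rcases Nat.even_or_odd (finrank F N) with hN | hN
    · refine ⟨⟨_, _, h.sup hs ho h', ?_⟩, ⟨_, _, h.sup hs ho h1', ?_⟩⟩
      · rw [(key _ _ _ _ h h').2]; exact hN.add e'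
      · rw [(key _ _ _ _ h h1').2]; exact hN.add_odd e1'
    · refine ⟨⟨_, _, h.sup hs ho h1', ?_⟩, ⟨_, _, h.sup hs ho h', ?_⟩⟩
      · rw [(key _ _ _ _ h h1').2]; exact hN.add_odd e1'
      · rw [(key _ _ _ _ h h').2]; exact hN.add_even e'
  · right
    rcases Nat.even_or_odd (finrank F N') with hN | hN
    · refine ⟨⟨_, _, h.sup hs ho h', ?_⟩, ⟨_, _, h1.sup hs ho h', ?_⟩⟩
      · rw [(key _ _ _ _ h h').2]; exact e.add hN
      · rw [(key _ _ _ _ h1 h').2]; exact e1.add_even hN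
    · refine ⟨⟨_, _, h1.sup hs ho h', ?_⟩, ⟨_, _, h.sup hs ho h', ?_⟩⟩
      · rw [(key _ _ _ _ h1 h').2]; exact e1.add_odd hN
      · rw [(key _ _ _ _ h h').2]; exact e.add_odd hN
  · right
    refine ⟨⟨_, _, h.sup hs ho h', ?_⟩, ⟨_, _, h.sup hs ho h1', ?_⟩⟩
    · rw [(key _ _ _ _ h h').2]; exact e.add e'
    · rw [(key _ _ _ _ h h1').2]; exact e.add_odd e1'

theorem PN.transfer {B : LinearMap.BilinForm F V} {X Y : V →ₗ[F] V} {K : Submodule F V}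
    {B' : LinearMap.BilinForm F K} {X' Y' : K →ₗ[F] K} (hB : ∀ x y : K, B' x y = B x y)
    (hX : ∀ x : K, (X' x : V) = X x) (hY : ∀ x : K, (Y' x : V) = Y x) {P N : Submodule F K}
    (h : PN B' X' Y' ⊤ P N) : PN B X Y K (P.map K.subtype) (N.map K.subtype) := by
  obtain ⟨h1, h2, h3, h4⟩ := h
  refine ⟨?_, ?_, ?_, ?_⟩
  · rw [← Submodule.map_sup, h1, Submodule.map_top, Submodule.range_subtype]
  · rintro _ ⟨p, hp, rfl⟩ _ ⟨n, hn, rfl⟩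
    have := h2 p hp n hn
    rwa [hB] at this
  · rintro _ ⟨p, hp, rfl⟩
    exact ⟨⟨_, (h3 p hp).1, hX p⟩, ⟨_, (h3 p hp).2, hY p⟩⟩
  · rintro _ ⟨p, hp, rfl⟩
    exact ⟨⟨_, (h4 p hp).1, hX p⟩, ⟨_, (h4 p hp).2, hY p⟩⟩

theorem GoodOn.transfer {B : LinearMap.BilinForm F V} {X Y : V →ₗ[F] V} {K : Submodule F V}
    {B' : LinearMap.BilinForm F K} {X' Y' : K →ₗ[F] K} (hB : ∀ x y : K, B' x y = B x y)
    (hX : ∀ x : K, (X' x : V) = X x) (hY : ∀ x : K, (Y' x : V) = Y x)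
    (h : GoodOn B' X' Y' ⊤) : GoodOn B X Y K := by
  have key : ∀ P : Submodule F K, finrank F (P.map K.subtype) = finrank F P := fun P =>
    (Submodule.equivSubtypeMap K P).symm.finrank_eq
  rcases h with ⟨P, N, h, e⟩ | ⟨⟨P, N, h, e⟩, ⟨P1, N1, h1, e1⟩⟩
  · exact Or.inl ⟨_, _, h.transfer hB hX hY, by rw [key, key, e]⟩
  · exact Or.inr ⟨⟨_, _, h.transfer hB hX hY, by rwa [key]⟩,
      ⟨_, _, h1.transfer hB hX hY, by rwa [key]⟩⟩

theorem tri_core {B : LinearMap.BilinForm F V} {b : ℕ → V} {k : ℕ}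
    (h0 : ∀ i j, i ≤ k → j ≤ k → k < i + j → B (b i) (b j) = 0)
    (h1 : ∀ i, i ≤ k → B (b i) (b (k - i)) ≠ 0)
    (a : Fin (k + 1) → F) (ha : ∀ j, j ≤ k → B (∑ i, a i • b i) (b j) = 0) :
    ∀ m (hm : m < k + 1), a ⟨m, hm⟩ = 0 := by
  intro m
  induction m using Nat.strong_induction_on with
  | _ m ih =>
  intro hm
  have := ha (k - m) (Nat.sub_le _ _)
  rw [map_sum, LinearMap.sum_apply, Finset.sum_eq_single ⟨m, hm⟩] at this
  · simp only [map_smul, LinearMap.smul_apply, smul_eq_mul] at this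
    exact (mul_eq_zero.1 this).resolve_right (h1 m (by omega))
  · rintro ⟨i, hi⟩ _ hne
    rcases lt_trichotomy i m with h | h | h
    · simp [ih i h hi]
    · exact absurd (Fin.ext h) hne
    · simp [h0 i (k - m) (by omega) (by omega) (by omega)]
  · simp

theorem tri_nondeg {B : LinearMap.BilinForm F V} {b : ℕ → V} {k : ℕ}
    (h0 : ∀ i j, i ≤ k → j ≤ k → k < i + j → B (b i) (b j) = 0)
    (h1 : ∀ i, i ≤ k → B (b i) (b (k - i)) ≠ 0) :
    ∀ x ∈ Submodule.span F (Set.range fun i : Fin (k + 1) => b i),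
      (∀ y ∈ Submodule.span F (Set.range fun i : Fin (k + 1) => b i), B x y = 0) → x = 0 := by
  intro x hx hy
  obtain ⟨a, rfl⟩ := (Submodule.mem_span_range_iff_exists_fun F).1 hx
  have := tri_core h0 h1 a (fun j hj => hy _ (Submodule.subset_span ⟨⟨j, by omega⟩, rfl⟩))
  exact Finset.sum_eq_zero fun i _ => by rw [this i.1 i.2, zero_smul]

theorem tri_finrank {B : LinearMap.BilinForm F V} {b : ℕ → V} {k : ℕ}
    (h0 : ∀ i j, i ≤ k → j ≤ k → k < i + j → B (b i) (b j) = 0)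
    (h1 : ∀ i, i ≤ k → B (b i) (b (k - i)) ≠ 0) :
    finrank F (Submodule.span F (Set.range fun i : Fin (k + 1) => b i)) = k + 1 := by
  have : LinearIndependent F (fun i : Fin (k + 1) => b i) := by
    rw [Fintype.linearIndependent_iff]
    intro a ha i
    exact tri_core h0 h1 a (fun j hj => by rw [ha]; simp) i.1 i.2
  rw [finrank_span_eq_card this, Fintype.card_fin]
end LA
end Stmt15

namespace Stmt15
open Module

section LA2
variable {F : Type*} [Field F] {V : Type*} [AddCommGroup V] [Module F V]

theorem nilp_not_mem (D : V →ₗ[F] V) {u : V} {k : ℕ} (h1 : (D ^ (k + 1)) u = 0)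
    (h2 : (D ^ k) u ∈ Submodule.span F (Set.range fun i : Fin k => (D ^ (i : ℕ)) u)) :
    (D ^ k) u = 0 := by
  have hz : ∀ j, k < j → (D ^ j) u = 0 := by
    intro j hj
    obtain ⟨m, rfl⟩ := Nat.exists_eq_add_of_lt hj
    rw [show k + m + 1 = m + (k + 1) by ring, pow_add, Module.End.mul_apply, h1, map_zero]
  by_contra hne
  obtain ⟨c, hc⟩ := (Submodule.mem_span_range_iff_exists_fun F).1 h2
  have hc0 : ∀ m (hm : m < k), c ⟨m, hm⟩ = 0 := by
    intro m
    induction m using Nat.strong_induction_on with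
    | _ m ih =>
    intro hm
    have e := congrArg (fun x => (D ^ (k - m)) x) hc
    simp only [map_sum, map_smul, ← Module.End.mul_apply, ← pow_add] at e
    rw [hz (k - m + k) (by omega), Finset.sum_eq_single ⟨m, hm⟩] at e
    · simp only at e
      rw [show k - m + m = k by omega] at e
      exact (smul_eq_zero.1 e).resolve_right hne
    · rintro ⟨i, hi⟩ _ hin
      rcases lt_trichotomy i m with h | h | h
      · simp [ih i h hi]
      · exact absurd (Fin.ext h) hin
      · rw [hz _ (by simp only; omega), smul_zero]
    · simp
  apply hne
  rw [← hc]
  exact Finset.sum_eq_zero fun i _ => by rw [hc0 i.1 i.2, zero_smul]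

theorem skew_pow {B : LinearMap.BilinForm F V} {D D' : V →ₗ[F] V}
    (h : ∀ x y, B (D x) y = - B x (D' y)) (m : ℕ) :
    ∀ x y, B ((D ^ m) x) y = (-1) ^ m * B x ((D' ^ m) y) := by
  induction m with
  | zero => simp
  | succ m ih =>
    intro x y
    rw [pow_succ, Module.End.mul_apply, ih, h, pow_succ' D', Module.End.mul_apply, pow_succ]
    ring

theorem exists_rep [FiniteDimensional F V] {B : LinearMap.BilinForm F V}
    (hs : ∀ x y, B x y = B y x) (hnd : ∀ x, (∀ y, B x y = 0) → x = 0) (φ : V →ₗ[F] F) :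
    ∃ v, ∀ x, B x v = φ x := by
  have hinj : Function.Injective B := by
    rw [← LinearMap.ker_eq_bot, LinearMap.ker_eq_bot']
    intro x hx
    exact hnd x fun y => by rw [hx]; rfl
  have hsurj : Function.Surjective B :=
    (LinearMap.injective_iff_surjective_of_finrank_eq_finrank
      (Subspace.dual_finrank_eq (K := F) (V := V)).symm).1 hinj
  obtain ⟨v, hv⟩ := hsurj φ
  exact ⟨v, fun x => by rw [hs, hv]⟩

theorem exists_data [IsAlgClosed F] [FiniteDimensional F V] [Nontrivial V]
    {B : LinearMap.BilinForm F V}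
    (hs : ∀ x y, B x y = B y x) (hnd : ∀ x, (∀ y, B x y = 0) → x = 0)
    {X : V →ₗ[F] V} (hX : ∀ x y, B (X x) y = - B x (X y)) :
    ∃ (μ : F) (k : ℕ) (u v : V) , ((X - μ • 1) ^ (k + 1)) u = 0 ∧ ((X + μ • 1) ^ (k + 1)) v = 0 ∧
      B (((X - μ • 1) ^ k) u) v = 1 ∧ ∀ i < k, B (((X - μ • 1) ^ i) u) v = 0 := by
  obtain ⟨μ, hμ⟩ := Module.End.exists_eigenvalue X
  obtain ⟨x0, hx0, hx0n⟩ := hμ.exists_hasEigenvector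
  rw [Module.End.mem_eigenspace_iff] at hx0
  set D : V →ₗ[F] V := X - μ • 1 with hD
  have hDx0 : D x0 = 0 := by simp [hD, hx0]
  set n := finrank F V with hn
  have hnpos : 0 < n := finrank_pos
  have hex : ∃ j, ∀ x, (D ^ n) x = 0 → (D ^ j) x = 0 := ⟨n, fun x h => h⟩
  classical
  obtain ⟨k, hk⟩ : ∃ k, Nat.find hex = k + 1 := by
    refine Nat.exists_eq_succ_of_ne_zero fun h0 => ?_
    have := Nat.find_spec hex
    rw [h0] at this
    apply hx0n
    have := this x0 (by
      obtain ⟨m, hm⟩ := Nat.exists_eq_succ_of_ne_zero hnpos.ne'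
      rw [hm, pow_succ, Module.End.mul_apply, hDx0, map_zero])
    simpa using this
  have hk1 := Nat.find_spec hex
  rw [hk] at hk1
  have hk2 := Nat.find_min hex (m := k) (by omega)
  push Not at hk2
  obtain ⟨u, hu, hku⟩ := hk2
  have huk := hk1 u hu
  have hker : ∀ m x, (D ^ m) x = 0 → (D ^ (k + 1)) x = 0 := fun m x h =>
    hk1 x (Module.End.ker_pow_le_ker_pow_finrank D m h)
  have hnm : (D ^ k) u ∉ Submodule.span F (Set.range fun i : Fin k => (D ^ (i : ℕ)) u) ⊔
      LinearMap.range (D ^ (k + 1)) := by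
    intro hmem
    obtain ⟨a, ha, b, ⟨w, rfl⟩, hab⟩ := Submodule.mem_sup.1 hmem
    have hz : ∀ j, (D ^ (k + 1)) ((D ^ j) u) = 0 := by
      intro j
      rw [← Module.End.mul_apply, ← pow_add, add_comm, pow_add, Module.End.mul_apply, huk, map_zero]
    have ha0 : (D ^ (k + 1)) a = 0 := by
      have : Submodule.span F (Set.range fun i : Fin k => (D ^ (i : ℕ)) u) ≤
          LinearMap.ker (D ^ (k + 1)) := by
        rw [Submodule.span_le]
        rintro _ ⟨i, rfl⟩
        exact hz i
      exact this ha
    have hw : (D ^ (k + 1)) w = 0 := by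
      apply hker (k + 1 + (k + 1))
      have := congrArg (D ^ (k + 1)) hab
      rw [map_add, ha0, zero_add, hz] at this
      rw [pow_add, Module.End.mul_apply, this]
    rw [hw, add_zero] at hab
    exact hku (nilp_not_mem D huk (hab ▸ ha))
  obtain ⟨φ, hφ1, hφ2⟩ := Submodule.exists_le_ker_of_notMem hnm
  obtain ⟨v, hv⟩ := exists_rep hs hnd ((φ ((D ^ k) u))⁻¹ • φ)
  have hsk : ∀ x y, B (D x) y = - B x ((X + μ • 1 : V →ₗ[F] V) y) := by
    intro x y
    simp [hD, hX]
    ring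
  refine ⟨μ, k, u, v, huk, ?_, ?_, ?_⟩
  · apply hnd
    intro y
    have e : φ ((D ^ (k + 1)) y) = 0 :=
      hφ2 (Submodule.mem_sup_right (LinearMap.mem_range_self _ y))
    have := hv ((D ^ (k + 1)) y)
    rw [LinearMap.smul_apply, e, smul_zero, skew_pow hsk, hs] at this
    exact (mul_eq_zero.1 this).resolve_left (pow_ne_zero _ (by simp))
  · rw [hv, LinearMap.smul_apply, smul_eq_mul, inv_mul_cancel₀ hφ1]
  · intro i hi
    rw [hv, LinearMap.smul_apply]
    have : φ ((D ^ i) u) = 0 :=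
      hφ2 (Submodule.mem_sup_left (Submodule.subset_span ⟨⟨i, hi⟩, rfl⟩))
    rw [this, smul_zero]

theorem isotropic [NeZero (2 : F)] {B : LinearMap.BilinForm F V}
    {X : V →ₗ[F] V} (hX : ∀ x y, B (X x) y = - B x (X y)) {μ : F} (hμ : μ ≠ 0) (s : ℕ) :
    ∀ m n, m + n = s → ∀ x y, ((X - μ • 1) ^ m) x = 0 → ((X - μ • 1) ^ n) y = 0 → B x y = 0 := by
  induction s with
  | zero =>
    intro m n h x y hx hy
    obtain rfl : m = 0 := by omega
    simp at hx
    simp [hx]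
  | succ s ih =>
    intro m n h x y hx hy
    rcases m with _ | m
    · simp at hx
      simp [hx]
    rcases n with _ | n
    · simp at hy
      simp [hy]
    rw [pow_succ, Module.End.mul_apply] at hx hy
    have e1 := ih m (n + 1) (by omega) _ y hx (by rw [pow_succ, Module.End.mul_apply, hy])
    have e2 := ih (m + 1) n (by omega) x _ (by rw [pow_succ, Module.End.mul_apply, hx]) hy
    simp [hX] at e1 e2
    have : 2 * μ * B x y = 0 := by linear_combination -e1 - e2
    exact (mul_eq_zero.1 this).resolve_left (mul_ne_zero two_ne_zero hμ)
end LA2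
end Stmt15

namespace Stmt15
open Module

section LA3
variable {F : Type*} [Field F] {V : Type*} [AddCommGroup V] [Module F V]

/-- nondegeneracy on a subspace -/
def NDOn (B : LinearMap.BilinForm F V) (W : Submodule F V) : Prop :=
  ∀ x ∈ W, (∀ y ∈ W, B x y = 0) → x = 0

theorem NDOn.sup {B : LinearMap.BilinForm F V} (hs : ∀ x y, B x y = B y x) {P N : Submodule F V}
    (hP : NDOn B P) (hN : NDOn B N) (ho : ∀ p ∈ P, ∀ n ∈ N, B p n = 0) : NDOn B (P ⊔ N) := by
  intro x hx hy
  obtain ⟨p, hp, n, hn, rfl⟩ := Submodule.mem_sup.1 hx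
  have h1 : p = 0 := by
    refine hP p hp fun y hyP => ?_
    have := hy y (Submodule.mem_sup_left hyP)
    rwa [map_add, LinearMap.add_apply, hs n y, ho y hyP n hn, add_zero] at this
  have h2 : n = 0 := by
    refine hN n hn fun y hyN => ?_
    have := hy y (Submodule.mem_sup_right hyN)
    rwa [map_add, LinearMap.add_apply, ho p hp y hyN, zero_add] at this
  rw [h1, h2, add_zero]

theorem span_orth {B : LinearMap.BilinForm F V} {S T : Set V}
    (h : ∀ x ∈ S, ∀ y ∈ T, B x y = 0) :
    ∀ x ∈ Submodule.span F S, ∀ y ∈ Submodule.span F T, B x y = 0 := by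
  intro x hx y hy
  induction hx using Submodule.span_induction with
  | mem x hx =>
    induction hy using Submodule.span_induction with
    | mem y hy => exact h x hx y hy
    | zero => simp
    | add a b _ _ ha hb => simp [ha, hb]
    | smul c a _ ha => simp [ha]
  | zero => simp
  | add a b _ _ ha hb => simp [ha, hb]
  | smul c a _ ha => simp [ha]

theorem span_maps {X : V →ₗ[F] V} {S : Set V} {N : Submodule F V}
    (h : ∀ x ∈ S, X x ∈ N) : ∀ x ∈ Submodule.span F S, X x ∈ N := by
  have : Submodule.span F S ≤ N.comap X := by
    rw [Submodule.span_le]; exact h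
  exact this

/-- What a split-off piece has to satisfy. -/
def Piece (B : LinearMap.BilinForm F V) (X : V →ₗ[F] V) (M : Submodule F V) : Prop :=
  M ≠ ⊥ ∧ (∀ x ∈ M, X x ∈ M) ∧ NDOn B M ∧ GoodOn B X 0 M

theorem piece_of_two {B : LinearMap.BilinForm F V} (hs : ∀ x y, B x y = B y x) {X : V →ₗ[F] V}
    {p n : ℕ → V} {k : ℕ}
    (hp0 : ∀ i j, i ≤ k → j ≤ k → k < i + j → B (p i) (p j) = 0)
    (hp1 : ∀ i, i ≤ k → B (p i) (p (k - i)) ≠ 0)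
    (hn0 : ∀ i j, i ≤ k → j ≤ k → k < i + j → B (n i) (n j) = 0)
    (hn1 : ∀ i, i ≤ k → B (n i) (n (k - i)) ≠ 0)
    (ho : ∀ i j, i ≤ k → j ≤ k → B (p i) (n j) = 0)
    (hXp : ∀ i, i ≤ k → X (p i) ∈ Submodule.span F (Set.range fun i : Fin (k + 1) => n i))
    (hXn : ∀ i, i ≤ k → X (n i) ∈ Submodule.span F (Set.range fun i : Fin (k + 1) => p i)) :
    ∃ M, Piece B X M := by
  set P := Submodule.span F (Set.range fun i : Fin (k + 1) => p i) with hP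
  set N := Submodule.span F (Set.range fun i : Fin (k + 1) => n i) with hN
  have hfP : finrank F P = k + 1 := tri_finrank hp0 hp1
  have hfN : finrank F N = k + 1 := tri_finrank hn0 hn1
  have hoPN : ∀ x ∈ P, ∀ y ∈ N, B x y = 0 := by
    apply span_orth
    rintro _ ⟨i, rfl⟩ _ ⟨j, rfl⟩
    exact ho i j (by omega) (by omega)
  have hXP : ∀ x ∈ P, X x ∈ N := by
    apply span_maps
    rintro _ ⟨i, rfl⟩
    exact hXp i (by omega)
  have hXN : ∀ x ∈ N, X x ∈ P := by
    apply span_maps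
    rintro _ ⟨i, rfl⟩
    exact hXn i (by omega)
  refine ⟨P ⊔ N, ?_, ?_, ?_, ?_⟩
  · intro h
    have : P = ⊥ := by rw [eq_bot_iff, ← h]; exact le_sup_left
    rw [this, finrank_bot] at hfP
    omega
  · intro x hx
    obtain ⟨a, ha, b, hb, rfl⟩ := Submodule.mem_sup.1 hx
    rw [map_add, add_comm]
    exact Submodule.add_mem_sup (hXN b hb) (hXP a ha)
  · exact NDOn.sup hs (tri_nondeg hp0 hp1) (tri_nondeg hn0 hn1) hoPN
  · exact Or.inl ⟨P, N, ⟨rfl, hoPN, fun x hx => ⟨hXP x hx, by simp⟩,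
      fun x hx => ⟨hXN x hx, by simp⟩⟩, by rw [hfP, hfN]⟩

theorem exists_piece [NeZero (2 : F)] [IsAlgClosed F] [FiniteDimensional F V] [Nontrivial V]
    {B : LinearMap.BilinForm F V}
    (hs : ∀ x y, B x y = B y x) (hnd : ∀ x, (∀ y, B x y = 0) → x = 0)
    {X : V →ₗ[F] V} (hX : ∀ x y, B (X x) y = - B x (X y)) :
    ∃ M, Piece B X M := by
  obtain ⟨μ, k, u, v, hu, hv, huv, huv0⟩ := exists_data hs hnd hX
  have hz : ∀ (D : V →ₗ[F] V) (u : V), (D ^ (k + 1)) u = 0 → ∀ j, k < j → (D ^ j) u = 0 := by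
    intro D u h j hj
    obtain ⟨m, rfl⟩ := Nat.exists_eq_add_of_lt hj
    rw [show k + m + 1 = m + (k + 1) by ring, pow_add, Module.End.mul_apply, h, map_zero]
  by_cases hμ : μ = 0
  · subst hμ
    simp only [zero_smul, sub_zero, add_zero] at hu hv huv huv0
    have hc : ∀ m, m ≠ k → B ((X ^ m) u) v = 0 := by
      intro m hm
      rcases lt_or_gt_of_ne hm with h | h
      · exact huv0 m h
      · rw [hz X u hu m h]; simp
    have hself : ∀ w i j, B ((X ^ i) w) ((X ^ j) w) = (-1) ^ i * B w ((X ^ (i + j)) w) := by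
      intro w i j
      rw [skew_pow hX, pow_add, Module.End.mul_apply]
    have hodd : ∀ w m, Odd m → B w ((X ^ m) w) = 0 := by
      intro w m hm
      have e := skew_pow hX m w w
      rw [hm.neg_one_pow, hs] at e
      have : 2 * B w ((X ^ m) w) = 0 := by linear_combination e
      exact (mul_eq_zero.1 this).resolve_left two_ne_zero
    have hgt : ∀ w, (X ^ (k + 1)) w = 0 → ∀ i j, k < i + j → B ((X ^ i) w) ((X ^ j) w) = 0 := by
      intro w hw i j hij
      rw [hself, hz X w hw _ hij]; simp
    rcases Nat.even_or_odd k with hk | hk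
    · -- even case: one cyclic block
      obtain ⟨w, hw, hw1⟩ : ∃ w, (X ^ (k + 1)) w = 0 ∧ B w ((X ^ k) w) ≠ 0 := by
        by_contra hcon
        push Not at hcon
        have e1 := hcon u hu
        have e2 := hcon v hv
        have e3 := hcon (u + v) (by rw [map_add, hu, hv, add_zero])
        have e4 := skew_pow hX k u v
        rw [hk.neg_one_pow, one_mul, huv] at e4
        have e5 : B v ((X ^ k) u) = 1 := by rw [hs, huv]
        simp only [map_add, LinearMap.add_apply, e1, e2, ← e4, e5] at e3
        apply two_ne_zero (α := F)
        linear_combination e3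
      set b : ℕ → V := fun i => (X ^ i) w with hb
      have h0 : ∀ i j, i ≤ k → j ≤ k → k < i + j → B (b i) (b j) = 0 :=
        fun i j _ _ hij => hgt w hw i j hij
      have h1 : ∀ i, i ≤ k → B (b i) (b (k - i)) ≠ 0 := by
        intro i hi
        simp only [hb]
        rw [hself, show i + (k - i) = k by omega]
        exact mul_ne_zero (pow_ne_zero _ (by simp)) hw1
      set P := Submodule.span F {x | ∃ i, Even i ∧ x = b i} with hP
      set N := Submodule.span F {x | ∃ i, Odd i ∧ x = b i} with hN
      set M := Submodule.span F (Set.range fun i : Fin (k + 1) => b i) with hM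
      have hbM : ∀ i, b i ∈ M := by
        intro i
        rcases Nat.lt_or_ge k i with h | h
        · simp only [hb]; rw [hz X w hw i h]; exact zero_mem _
        · exact Submodule.subset_span ⟨⟨i, by omega⟩, rfl⟩
      have hXb : ∀ i, X (b i) = b (i + 1) := fun i => by
        simp only [hb]; rw [pow_succ', Module.End.mul_apply]
      have hPN : P ⊔ N = M := by
        apply le_antisymm
        · refine sup_le ?_ ?_ <;> rw [Submodule.span_le] <;> rintro _ ⟨i, -, rfl⟩ <;> exact hbM i
        · rw [hM, Submodule.span_le]
          rintro _ ⟨i, rfl⟩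
          rcases Nat.even_or_odd (i : ℕ) with h | h
          · exact Submodule.mem_sup_left (Submodule.subset_span ⟨i, h, rfl⟩)
          · exact Submodule.mem_sup_right (Submodule.subset_span ⟨i, h, rfl⟩)
      have ho : ∀ x ∈ P, ∀ y ∈ N, B x y = 0 := by
        apply span_orth
        rintro _ ⟨i, hi, rfl⟩ _ ⟨j, hj, rfl⟩
        simp only [hb]
        rw [hself, hodd _ _ (hi.add_odd hj), mul_zero]
      have hXP : ∀ x ∈ P, X x ∈ N := by
        apply span_maps
        rintro _ ⟨i, hi, rfl⟩
        rw [hXb]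
        exact Submodule.subset_span ⟨_, hi.add_one, rfl⟩
      have hXN : ∀ x ∈ N, X x ∈ P := by
        apply span_maps
        rintro _ ⟨i, hi, rfl⟩
        rw [hXb]
        exact Submodule.subset_span ⟨_, hi.add_one, rfl⟩
      have hND : NDOn B M := tri_nondeg h0 h1
      have hfr : finrank F M = k + 1 := tri_finrank h0 h1
      have hdisj : Disjoint P N := by
        rw [Submodule.disjoint_def]
        intro x hxP hxN
        refine hND x (hPN ▸ Submodule.mem_sup_left hxP) fun y hy => ?_
        rw [← hPN] at hy
        obtain ⟨a, ha, c, hc, rfl⟩ := Submodule.mem_sup.1 hy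
        rw [map_add, ho x hxP c hc, hs, ho a ha x hxN, add_zero]
      have hsum := finrank_sup_of_disj hdisj
      rw [hPN, hfr] at hsum
      have hpn : PN B X 0 M P N := ⟨hPN, ho, fun x hx => ⟨hXP x hx, by simp⟩,
        fun x hx => ⟨hXN x hx, by simp⟩⟩
      refine ⟨M, ?_, ?_, hND, Or.inr ?_⟩
      · intro h
        rw [h, finrank_bot] at hfr
        omega
      · apply span_maps
        rintro _ ⟨i, rfl⟩
        simp only [hXb]
        exact hbM _
      · have hodd1 : Odd (finrank F P + finrank F N) := hsum ▸ hk.add_one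
        rcases Nat.even_or_odd (finrank F N) with h | h
        · exact ⟨⟨P, N, hpn, h⟩, ⟨N, P, hpn.symm hs, (Nat.odd_add.1 hodd1).2 h⟩⟩
        · refine ⟨⟨N, P, hpn.symm hs, ?_⟩, ⟨P, N, hpn, h⟩⟩
          rw [add_comm] at hodd1
          exact (Nat.odd_add.1 hodd1).1 h
    · -- odd case: two cyclic blocks
      have huvij : ∀ i j, B ((X ^ i) u) ((X ^ j) v) = (-1) ^ j * B ((X ^ (i + j)) u) v := by
        intro i j
        rw [add_comm, pow_add, Module.End.mul_apply, skew_pow hX j, ← mul_assoc, ← mul_pow]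
        simp
      have huvne : ∀ i j, i + j = k → B ((X ^ i) u) ((X ^ j) v) ≠ 0 := by
        intro i j h
        rw [huvij, h, huv, mul_one]
        exact pow_ne_zero _ (by simp)
      have huv0' : ∀ i j, i + j ≠ k → B ((X ^ i) u) ((X ^ j) v) = 0 := by
        intro i j h
        rw [huvij, hc _ h, mul_zero]
      have hselfodd : ∀ w i j, Odd (i + j) → B ((X ^ i) w) ((X ^ j) w) = 0 := by
        intro w i j h
        rw [hself, hodd _ _ h, mul_zero]
      have hXb : ∀ w i, X ((X ^ i) w) = (X ^ (i + 1)) w := fun w i => by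
        rw [pow_succ', Module.End.mul_apply]
      have main : ∀ u v, (X ^ (k + 1)) u = 0 → (X ^ (k + 1)) v = 0 →
          ∀ i ≤ k, X (if Even i then (X ^ i) u else (X ^ i) v) ∈
          Submodule.span F (Set.range fun i : Fin (k + 1) =>
            if Even (i : ℕ) then (X ^ (i : ℕ)) v else (X ^ (i : ℕ)) u) := by
        intro u v hu hv i hi
        have e : X (if Even i then (X ^ i) u else (X ^ i) v) =
            if Even (i + 1) then (X ^ (i + 1)) v else (X ^ (i + 1)) u := by
          rcases Nat.even_or_odd i with h | h
          · rw [if_pos h, if_neg (by simpa using h.add_one), hXb]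
          · rw [if_neg (by simpa using h), if_pos h.add_one, hXb]
        rw [e]
        rcases Nat.lt_or_ge k (i + 1) with h | h
        · rw [hz X u hu _ h, hz X v hv _ h]; simp
        · exact Submodule.subset_span ⟨⟨i + 1, by omega⟩, rfl⟩
      refine piece_of_two hs (k := k) (p := fun i => if Even i then (X ^ i) u else (X ^ i) v)
        (n := fun i => if Even i then (X ^ i) v else (X ^ i) u) ?_ ?_ ?_ ?_ ?_
        (main u v hu hv) (main v u hv hu)
      · intro i j _ _ hij
        split_ifs
        · exact hgt u hu _ _ hij
        · exact huv0' _ _ (by omega)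
        · rw [hs]; exact huv0' _ _ (by omega)
        · exact hgt v hv _ _ hij
      · intro i hi
        have : Odd (i + (k - i)) := by rwa [show i + (k - i) = k by omega]
        split_ifs with h1 h2 h2
        · exact absurd this (by simpa using h1.add h2)
        · exact huvne _ _ (by omega)
        · rw [hs]; exact huvne _ _ (by omega)
        · exact absurd this (by simpa using (Nat.not_even_iff_odd.1 h1).add_odd (Nat.not_even_iff_odd.1 h2))
      · intro i j _ _ hij
        split_ifs
        · exact hgt v hv _ _ hij
        · rw [hs]; exact huv0' _ _ (by omega)
        · exact huv0' _ _ (by omega)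
        · exact hgt u hu _ _ hij
      · intro i hi
        have : Odd (i + (k - i)) := by rwa [show i + (k - i) = k by omega]
        split_ifs with h1 h2 h2
        · exact absurd this (by simpa using h1.add h2)
        · rw [hs]; exact huvne _ _ (by omega)
        · exact huvne _ _ (by omega)
        · exact absurd this (by simpa using (Nat.not_even_iff_odd.1 h1).add_odd (Nat.not_even_iff_odd.1 h2))
      · intro i j _ _
        split_ifs with h1 h2 h2
        · apply huv0'
          rintro rfl
          exact absurd hk (by simpa using h1.add h2)
        · exact hselfodd _ _ _ (h1.add_odd (Nat.not_even_iff_odd.1 h2))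
        · exact hselfodd _ _ _ ((Nat.not_even_iff_odd.1 h1).add_even h2)
        · rw [hs]
          apply huv0'
          rintro rfl
          exact absurd hk (by simpa using (Nat.not_even_iff_odd.1 h2).add_odd (Nat.not_even_iff_odd.1 h1))
  · -- nonzero eigenvalue
    set D : V →ₗ[F] V := X - μ • 1 with hD
    set D' : V →ₗ[F] V := X + μ • 1 with hD'
    have hDm : ∀ m j, (D ^ m) u = 0 → (D ^ m) ((D ^ j) u) = 0 := by
      intro m j h
      rw [← Module.End.mul_apply, ← pow_add, add_comm, pow_add, Module.End.mul_apply, h, map_zero]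
    have hDm' : ∀ m j, (D' ^ m) v = 0 → (D' ^ m) ((D' ^ j) v) = 0 := by
      intro m j h
      rw [← Module.End.mul_apply, ← pow_add, add_comm, pow_add, Module.End.mul_apply, h, map_zero]
    have huu : ∀ i j, B ((D ^ i) u) ((D ^ j) u) = 0 := fun i j =>
      isotropic hX hμ _ (k + 1) (k + 1) rfl _ _ (hDm _ i hu) (hDm _ j hu)
    have hD'' : D' = X - (-μ) • 1 := by rw [hD', neg_smul, sub_neg_eq_add]
    have hvv : ∀ i j, B ((D' ^ i) v) ((D' ^ j) v) = 0 := fun i j =>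
      isotropic hX (neg_ne_zero.2 hμ) _ (k + 1) (k + 1) rfl _ _
        (by rw [← hD'']; exact hDm' _ i hv) (by rw [← hD'']; exact hDm' _ j hv)
    have hsk : ∀ x y, B (D x) y = - B x (D' y) := by
      intro x y
      simp [hD, hD', hX]
      ring
    have huvij : ∀ i j, B ((D ^ i) u) ((D' ^ j) v) = (-1) ^ j * B ((D ^ (i + j)) u) v := by
      intro i j
      rw [add_comm, pow_add, Module.End.mul_apply, skew_pow hsk j, ← mul_assoc, ← mul_pow]
      simp
    have hc : ∀ m, m ≠ k → B ((D ^ m) u) v = 0 := by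
      intro m hm
      rcases lt_or_gt_of_ne hm with h | h
      · exact huv0 m h
      · rw [hz D u hu m h]; simp
    have hvuij : ∀ i j, B ((D' ^ j) v) ((D ^ i) u) = (-1) ^ j * B ((D ^ (i + j)) u) v := by
      intro i j; rw [hs, huvij]
    have gram : ∀ (s s' : F) (i j : ℕ),
        B ((D ^ i) u + (s * (-1) ^ i) • (D' ^ i) v) ((D ^ j) u + (s' * (-1) ^ j) • (D' ^ j) v) =
          (s + s') * B ((D ^ (i + j)) u) v := by
      intro s s' i j
      have ei : ((-1 : F) ^ i) * (-1) ^ i = 1 := by rw [← mul_pow]; simp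
      have ej : ((-1 : F) ^ j) * (-1) ^ j = 1 := by rw [← mul_pow]; simp
      simp only [map_add, map_smul, LinearMap.add_apply, LinearMap.smul_apply, smul_eq_mul,
        huu, hvv, huvij, hvuij, add_comm j i]
      linear_combination s * B ((D ^ (i + j)) u) v * ei + s' * B ((D ^ (i + j)) u) v * ej
    have hXx : ∀ (s : F) (i : ℕ), X ((D ^ i) u + (s * (-1) ^ i) • (D' ^ i) v) =
        ((D ^ (i + 1)) u + ((-s) * (-1) ^ (i + 1)) • (D' ^ (i + 1)) v) +
          μ • ((D ^ i) u + ((-s) * (-1) ^ i) • (D' ^ i) v) := by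
      intro s i
      have e1 : X ((D ^ i) u) = (D ^ (i + 1)) u + μ • (D ^ i) u := by
        rw [pow_succ' D, Module.End.mul_apply]; simp [hD]
      have e2 : X ((D' ^ i) v) = (D' ^ (i + 1)) v - μ • (D' ^ i) v := by
        rw [pow_succ' D', Module.End.mul_apply]; simp [hD']
      rw [map_add, map_smul, e1, e2]
      module
    have main : ∀ (s : F) (i : ℕ), i ≤ k → X ((D ^ i) u + (s * (-1) ^ i) • (D' ^ i) v) ∈
        Submodule.span F (Set.range fun i : Fin (k + 1) =>
          (D ^ (i : ℕ)) u + ((-s) * (-1) ^ (i : ℕ)) • (D' ^ (i : ℕ)) v) := by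
      intro s i hi
      rw [hXx]
      refine add_mem ?_ (Submodule.smul_mem _ _ (Submodule.subset_span ⟨⟨i, by omega⟩, rfl⟩))
      rcases Nat.lt_or_ge k (i + 1) with h | h
      · rw [hz D u hu _ h, hz D' v hv _ h]; simp
      · exact Submodule.subset_span ⟨⟨i + 1, by omega⟩, rfl⟩
    refine piece_of_two hs (k := k) (p := fun i => (D ^ i) u + ((1 : F) * (-1) ^ i) • (D' ^ i) v)
      (n := fun i => (D ^ i) u + ((-1 : F) * (-1) ^ i) • (D' ^ i) v) ?_ ?_ ?_ ?_ ?_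
      (main 1) (by simpa only [neg_neg] using main (-1))
    · intro i j _ _ hij
      rw [gram, hc _ (by omega), mul_zero]
    · intro i hi
      rw [gram, show i + (k - i) = k by omega, huv, mul_one, one_add_one_eq_two]
      exact two_ne_zero
    · intro i j _ _ hij
      rw [gram, hc _ (by omega), mul_zero]
    · intro i hi
      rw [gram, show i + (k - i) = k by omega, huv, mul_one, ← neg_add, one_add_one_eq_two]
      exact neg_ne_zero.2 two_ne_zero
    · intro i j _ _
      rw [gram]; simp
end LA3
end Stmt15

namespace Stmt15
open Module

section LA4

theorem orth_compl {F : Type*} [Field F] {V : Type*} [AddCommGroup V] [Module F V]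
    [FiniteDimensional F V] {B : LinearMap.BilinForm F V}
    (hs : ∀ x y, B x y = B y x) {M : Submodule F V} (hM : NDOn B M) :
    ∃ K : Submodule F V, (∀ y, y ∈ K ↔ ∀ m ∈ M, B m y = 0) ∧ M ⊔ K = ⊤ ∧ Disjoint M K := by
  have hd : Disjoint M (B.orthogonal M) := by
    rw [Submodule.disjoint_def]
    intro x hx hx'
    refine hM x hx fun y hy => ?_
    rw [hs]
    exact LinearMap.BilinForm.mem_orthogonal_iff.1 hx' y hy
  have hr : B.IsRefl := fun x y h => by rw [hs]; exact h
  have hc := (LinearMap.BilinForm.isCompl_orthogonal_iff_disjoint hr).2 hd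
  exact ⟨B.orthogonal M, fun y => LinearMap.BilinForm.mem_orthogonal_iff,
    hc.sup_eq_top, hd⟩

theorem orth_nd {F : Type*} [Field F] {V : Type*} [AddCommGroup V] [Module F V]
    {B : LinearMap.BilinForm F V}
    (hs : ∀ x y, B x y = B y x) (hnd : ∀ x, (∀ y, B x y = 0) → x = 0) {M K : Submodule F V}
    (hK : ∀ y, y ∈ K ↔ ∀ m ∈ M, B m y = 0) (htop : M ⊔ K = ⊤) : NDOn B K := by
  intro x hx h
  refine hnd x fun y => ?_
  have hy : y ∈ M ⊔ K := htop ▸ Submodule.mem_top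
  obtain ⟨m, hm, k, hk, rfl⟩ := Submodule.mem_sup.1 hy
  rw [map_add, hs x m, (hK x).1 hx m hm, h k hk, add_zero]

theorem skew_good {F : Type*} [Field F] [IsAlgClosed F] [NeZero (2 : F)] (n : ℕ) :
    ∀ {V : Type*} [AddCommGroup V] [Module F V] [FiniteDimensional F V]
    {B : LinearMap.BilinForm F V} {X : V →ₗ[F] V} (_ : finrank F V = n)
    (_ : ∀ x y, B x y = B y x) (_ : ∀ x, (∀ y, B x y = 0) → x = 0)
    (_ : ∀ x y, B (X x) y = - B x (X y)), GoodOn B X 0 ⊤ := by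
  induction n using Nat.strong_induction_on with
  | _ n ih =>
  intro V _ _ _ B X hn hs hnd hX
  rcases Nat.eq_zero_or_pos n with h0 | hpos
  · have : Subsingleton V := finrank_zero_iff.1 (hn.trans h0)
    refine Or.inl ⟨⊥, ⊥, ⟨Subsingleton.elim _ _, ?_, ?_, ?_⟩, rfl⟩
    · intro p _ q _; rw [Subsingleton.elim p 0]; simp
    · intro p hp; exact ⟨by rw [Subsingleton.elim (X p) 0]; simp, by simp⟩
    · intro p hp; exact ⟨by rw [Subsingleton.elim (X p) 0]; simp, by simp⟩
  have : Nontrivial V := finrank_pos_iff.1 (hn ▸ hpos)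
  obtain ⟨M, hM0, hMX, hMnd, hMg⟩ := exists_piece hs hnd hX
  obtain ⟨K, hK, htop, hdisj⟩ := orth_compl hs hMnd
  have hKnd := orth_nd hs hnd hK htop
  have hKX : ∀ x ∈ K, X x ∈ K := by
    intro x hx
    rw [hK]
    intro m hm
    have := hX m x
    rw [(hK x).1 hx _ (hMX m hm)] at this
    simpa using this.symm
  have hfr := finrank_sup_of_disj hdisj
  rw [htop, finrank_top, hn] at hfr
  have hMpos : 0 < finrank F M := by
    rw [Nat.pos_iff_ne_zero]; intro h; exact hM0 (Submodule.finrank_eq_zero.1 h)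
  have := @ih (finrank F K) (by omega) K _ _ _ (B.restrict K) (X.restrict hKX) rfl
    (fun x y => hs x y) (fun x h => Subtype.ext (hKnd x x.2 fun y hy => h ⟨y, hy⟩))
    (fun x y => hX x y)
  have hg := this.transfer (B := B) (X := X) (Y := 0) (fun x y => rfl) (fun x => rfl) (fun x => rfl)
  rw [← htop]
  exact hMg.sup hs (fun x hx y hy => (hK y).1 hy x hx) hdisj hg

variable {F : Type*} [Field F] {V : Type*} [AddCommGroup V] [Module F V]

/-- Cayley transform step. `h`, `h'` mutually inverse isometries, `h + 1` inverted by `j`. -/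
theorem cayley_good [IsAlgClosed F] [NeZero (2 : F)] [FiniteDimensional F V]
    {B : LinearMap.BilinForm F V} {h h' : V →ₗ[F] V}
    (hs : ∀ x y, B x y = B y x) (hnd : ∀ x, (∀ y, B x y = 0) → x = 0)
    (hh' : h * h' = 1) (hiso : ∀ x y, B (h x) (h y) = B x y)
    (hinj : ∀ x, h x = -x → x = 0) : GoodOn B (h - h') (h + h') ⊤ := by
  have hh'' : h' * h = 1 := mul_eq_one_comm.1 hh'
  have hbij : Function.Injective (h + 1 : V →ₗ[F] V) := by
    rw [injective_iff_map_eq_zero]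
    intro x hx
    exact hinj x (eq_neg_of_add_eq_zero_left hx)
  let e := LinearEquiv.ofInjectiveEndo (h + 1) hbij
  let j : V →ₗ[F] V := e.symm
  have he : ∀ x, h (j x) + j x = x := fun x => e.apply_symm_apply x
  let X : V →ₗ[F] V := (h - 1) * j
  have hsurj : ∀ x, ∃ y, x = h y + y := fun x => ⟨j x, (he x).symm⟩
  have hj : ∀ y, j (h y + y) = y := fun x => e.symm_apply_apply x
  have hXy : ∀ y, X (h y + y) = h y - y := fun y => by
    change (h - 1) (j (h y + y)) = _
    rw [hj]; rfl
  have hX : ∀ x y, B (X x) y = - B x (X y) := by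
    intro x y
    obtain ⟨x, rfl⟩ := hsurj x
    obtain ⟨y, rfl⟩ := hsurj y
    rw [hXy, hXy]
    simp [hiso]; ring
  have hhX : ∀ x, h (x - X x) = x + X x := by
    intro x
    obtain ⟨y, rfl⟩ := hsurj x
    rw [hXy]; simp
  have h2 : (2 : F) ≠ 0 := NeZero.ne 2
  have hi1 : ∀ x, x - X x = 0 → x = 0 := by
    intro x hx
    obtain ⟨y, rfl⟩ := hsurj x
    rw [hXy, add_sub_sub_cancel, ← two_smul F, smul_eq_zero] at hx
    rw [hx.resolve_left h2]; simp
  have hi2 : ∀ x, x + X x = 0 → x = 0 := by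
    intro x hx
    refine hi1 x ?_
    rw [← hhX] at hx
    have := congrArg h' hx
    rwa [map_zero, show h' (h (x - X x)) = x - X x from LinearMap.congr_fun hh'' _] at this
  -- relation: for every decomposition
  have key : ∀ P N, PN B X 0 ⊤ P N → PN B (h - h') (h + h') ⊤ P N := by
    have one : ∀ P N : Submodule F V, (P ⊔ N = ⊤) → (∀ p ∈ P, ∀ n ∈ N, B p n = 0) →
        (∀ p ∈ P, X p ∈ N) → (∀ n ∈ N, X n ∈ P) →
        ∀ p ∈ P, (h - h') p ∈ N ∧ (h + h') p ∈ P := by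
      intro P N htop ho hP hN p hp
      let Y : P →ₗ[F] P := ((1 : V →ₗ[F] V) - X * X).restrict (p := P) (q := P) (fun x hx =>
        P.sub_mem hx (hN _ (hP x hx)))
      have hYi : Function.Injective Y := by
        rw [injective_iff_map_eq_zero]
        rintro ⟨x, hx⟩ h0
        have h0' : x - X (X x) = 0 := congrArg Subtype.val h0
        have : (x + X x) - X (x + X x) = 0 := by rw [map_add]; rw [← h0']; abel
        exact Subtype.ext (hi2 x (hi1 _ this))
      obtain ⟨⟨p0, hp0⟩, h0⟩ := (LinearMap.injective_iff_surjective.1 hYi) ⟨p, hp⟩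
      have h0' : p0 - X (X p0) = p := congrArg Subtype.val h0
      have e1 : h p = p0 + (2 : F) • X p0 + X (X p0) := by
        have : p = (p0 + X p0) - X (p0 + X p0) := by rw [map_add, ← h0']; abel
        rw [this, hhX, map_add, two_smul]; abel
      have e2 : h' p = p0 - (2 : F) • X p0 + X (X p0) := by
        have : p = h (p0 - (2 : F) • X p0 + X (X p0)) := by
          have : p0 - (2 : F) • X p0 + X (X p0) = (p0 - X p0) - X (p0 - X p0) := by
            rw [map_sub, two_smul]; abel
          rw [this, hhX, map_sub, ← h0']; abel
        rw [this]; exact LinearMap.congr_fun hh'' _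
      constructor
      · have : (h - h') p = (4 : F) • X p0 := by
          rw [LinearMap.sub_apply, e1, e2]; module
        rw [this]; exact N.smul_mem _ (hP _ hp0)
      · have : (h + h') p = (2 : F) • p0 + (2 : F) • X (X p0) := by
          rw [LinearMap.add_apply, e1, e2]; module
        rw [this]; exact P.add_mem (P.smul_mem _ hp0) (P.smul_mem _ (hN _ (hP _ hp0)))
    rintro P N ⟨h1, h2, h3, h4⟩
    refine ⟨h1, h2, one P N h1 h2 (fun p hp => (h3 p hp).1) (fun p hp => (h4 p hp).1),
      one N P (sup_comm P N ▸ h1) (fun p hp n hn => by rw [hs]; exact h2 n hn p hp)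
      (fun p hp => (h4 p hp).1) (fun p hp => (h3 p hp).1)⟩
  rcases skew_good _ rfl hs hnd hX with ⟨P, N, h1, h2⟩ | ⟨⟨P, N, h1, h2⟩, ⟨P1, N1, h3, h4⟩⟩
  · exact Or.inl ⟨P, N, key _ _ h1, h2⟩
  · exact Or.inr ⟨⟨P, N, key _ _ h1, h2⟩, ⟨P1, N1, key _ _ h3, h4⟩⟩
end LA4
end Stmt15

namespace Stmt15
open Module

section LA5
variable {F : Type*} [Field F] {V : Type*} [AddCommGroup V] [Module F V]

theorem orth_nd' {B : LinearMap.BilinForm F V}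
    (hnd : ∀ x, (∀ y, B x y = 0) → x = 0) {M K : Submodule F V}
    (ho : ∀ x ∈ K, ∀ m ∈ M, B x m = 0) (htop : M ⊔ K = ⊤) : NDOn B K := by
  intro x hx h
  refine hnd x fun y => ?_
  have hy : y ∈ M ⊔ K := htop ▸ Submodule.mem_top
  obtain ⟨m, hm, k, hk, rfl⟩ := Submodule.mem_sup.1 hy
  rw [map_add, ho x hx m hm, h k hk, add_zero]

theorem GoodOn.neg {B : LinearMap.BilinForm F V} {X Y : V →ₗ[F] V} {W : Submodule F V}
    (h : GoodOn B X Y W) : GoodOn B (-X) (-Y) W := by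
  have key : ∀ P N, PN B X Y W P N → PN B (-X) (-Y) W P N := by
    rintro P N ⟨h1, h2, h3, h4⟩
    exact ⟨h1, h2, fun p hp => ⟨N.neg_mem (h3 p hp).1, P.neg_mem (h3 p hp).2⟩,
      fun p hp => ⟨P.neg_mem (h4 p hp).1, N.neg_mem (h4 p hp).2⟩⟩
  rcases h with ⟨P, N, h1, h2⟩ | ⟨⟨P, N, h1, h2⟩, ⟨P1, N1, h3, h4⟩⟩
  · exact Or.inl ⟨P, N, key _ _ h1, h2⟩
  · exact Or.inr ⟨⟨P, N, key _ _ h1, h2⟩, ⟨P1, N1, key _ _ h3, h4⟩⟩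

theorem isometry_good [IsAlgClosed F] [NeZero (2 : F)] [FiniteDimensional F V]
    {B : LinearMap.BilinForm F V} {g g' : V →ₗ[F] V}
    (hs : ∀ x y, B x y = B y x) (hnd : ∀ x, (∀ y, B x y = 0) → x = 0)
    (hgg' : g * g' = 1) (hiso : ∀ x y, B (g x) (g y) = B x y) :
    GoodOn B (g - g') (g + g') ⊤ := by
  have hg'g : g' * g = 1 := mul_eq_one_comm.1 hgg'
  obtain ⟨n, hn1, hc⟩ : ∃ n, 1 ≤ n ∧ IsCompl (LinearMap.ker ((g + 1) ^ n))
      (LinearMap.range ((g + 1) ^ n)) :=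
    ((Filter.eventually_ge_atTop 1).and
      (LinearMap.eventually_isCompl_ker_pow_range_pow (g + 1))).exists
  set W := LinearMap.ker ((g + 1) ^ n) with hW
  set U := LinearMap.range ((g + 1) ^ n) with hU
  have hcomm : Commute g (g + 1) := (Commute.refl g).add_right (Commute.one_right g)
  have hcomm' : Commute g' (g + 1) :=
    Commute.add_right (by rw [Commute, SemiconjBy, hgg', hg'g]) (Commute.one_right g')
  have inv : ∀ f : V →ₗ[F] V, Commute f (g + 1) → (∀ x ∈ W, f x ∈ W) ∧ (∀ x ∈ U, f x ∈ U) := by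
    intro f hf
    have hf' := hf.pow_right n
    constructor
    · intro x hx
      rw [hW, LinearMap.mem_ker] at hx ⊢
      have := LinearMap.congr_fun hf' x
      simp only [Module.End.mul_apply, hx, map_zero] at this
      exact this.symm
    · rintro _ ⟨z, rfl⟩
      exact ⟨f z, (LinearMap.congr_fun hf' z).symm⟩
  have adj : ∀ x y, B x (g y) = B (g' x) y := by
    intro x y
    rw [← hiso (g' x) y]
    rw [show g (g' x) = x from LinearMap.congr_fun hgg' x]
  have adj1 : ∀ x y, B x ((g + 1) y) = B ((g' + 1) x) y := by
    intro x y
    simp [adj]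
  have adjn : ∀ (m : ℕ) x y, B x (((g + 1) ^ m) y) = B (((g' + 1) ^ m) x) y := by
    intro m
    induction m with
    | zero => intro x y; rfl
    | succ m ih =>
      intro x y
      rw [pow_succ', Module.End.mul_apply, adj1, ih, pow_succ (g' + 1), Module.End.mul_apply]
  have hpow : (g' + 1) ^ n = g' ^ n * (g + 1) ^ n := by
    rw [← hcomm'.mul_pow, mul_add, hg'g, mul_one, add_comm]
  have ho : ∀ x ∈ W, ∀ y ∈ U, B x y = 0 := by
    rintro x hx _ ⟨z, rfl⟩
    rw [adjn, hpow, Module.End.mul_apply, LinearMap.mem_ker.1 hx]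
    simp
  have htop : W ⊔ U = ⊤ := hc.sup_eq_top
  have hWnd : NDOn B W := orth_nd' hnd ho (sup_comm W U ▸ htop)
  have hUnd : NDOn B U := orth_nd' hnd (fun x hx m hm => by rw [hs]; exact ho m hm x hx) htop
  have gW : GoodOn B (g - g') (g + g') W := by
    let h : W →ₗ[F] W := (-g).restrict (p := W) (q := W) (fun x hx => W.neg_mem ((inv g hcomm).1 x hx))
    let h' : W →ₗ[F] W := (-g').restrict (p := W) (q := W) (fun x hx => W.neg_mem ((inv g' hcomm').1 x hx))
    have := cayley_good (B := B.restrict W) (h := h) (h' := h') (fun x y => hs x y)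
      (fun x hx => Subtype.ext (hWnd x x.2 fun y hy => hx ⟨y, hy⟩))
      (by
        ext x
        change -g (-(g' x)) = x
        rw [map_neg, neg_neg]
        exact LinearMap.congr_fun hgg' x)
      (fun x y => by
        change B (-g x) (-g y) = B x y
        simp [hiso])
      (by
        rintro ⟨x, hx⟩ h0
        have h0' : -g x = -x := congrArg Subtype.val h0
        have h1 : (g + 1) x = (2 : F) • x := by
          rw [two_smul, LinearMap.add_apply, neg_inj.1 h0']; rfl
        have h2 : ∀ m : ℕ, ((g + 1) ^ m) x = (2 : F) ^ m • x := by
          intro m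
          induction m with
          | zero => simp
          | succ m ih => rw [pow_succ', Module.End.mul_apply, ih, map_smul, h1, smul_smul, pow_succ]
        have h3 := LinearMap.mem_ker.1 hx
        rw [h2, smul_eq_zero] at h3
        exact Subtype.ext (h3.resolve_left (pow_ne_zero _ (NeZero.ne 2))))
    have := (this.transfer (B := B) (X := -(g - g')) (Y := -(g + g')) (fun x y => rfl)
      (fun x => by change -g x - -g' x = -(g x - g' x); abel)
      (fun x => by change -g x + -g' x = -(g x + g' x); abel)).neg
    rwa [neg_neg, neg_neg] at this
  have gU : GoodOn B (g - g') (g + g') U := by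
    let h : U →ₗ[F] U := g.restrict (p := U) (q := U) (inv g hcomm).2
    let h' : U →ₗ[F] U := g'.restrict (p := U) (q := U) (inv g' hcomm').2
    have := cayley_good (B := B.restrict U) (h := h) (h' := h') (fun x y => hs x y)
      (fun x hx => Subtype.ext (hUnd x x.2 fun y hy => hx ⟨y, hy⟩))
      (by
        ext x
        exact LinearMap.congr_fun hgg' x)
      (fun x y => hiso x y)
      (by
        rintro ⟨x, hx⟩ h0
        have h0' : g x = -x := congrArg Subtype.val h0
        refine Subtype.ext ((Submodule.disjoint_def.1 hc.disjoint) x ?_ hx)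
        rw [hW, LinearMap.mem_ker]
        obtain ⟨m, rfl⟩ := Nat.exists_eq_add_of_le' hn1
        rw [pow_succ, Module.End.mul_apply]
        simp [h0'])
    exact this.transfer (B := B) (fun x y => rfl) (fun x => rfl) (fun x => rfl)
  rw [← htop]
  exact gW.sup hs ho hc.disjoint gU

theorem exists_even_PN [IsAlgClosed F] [NeZero (2 : F)] [FiniteDimensional F V]
    {B : LinearMap.BilinForm F V} {g g' : V →ₗ[F] V}
    (hs : ∀ x y, B x y = B y x) (hnd : ∀ x, (∀ y, B x y = 0) → x = 0)
    (hgg' : g * g' = 1) (hiso : ∀ x y, B (g x) (g y) = B x y)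
    (hdim : finrank F V % 4 = 0 ∨ finrank F V % 4 = 1 ∨ finrank F V % 4 = 3) :
    ∃ P N, PN B (g - g') (g + g') ⊤ P N ∧ Even (finrank F N) := by
  rcases isometry_good hs hnd hgg' hiso with ⟨P, N, h1, h2⟩ | ⟨h, -⟩
  · refine ⟨P, N, h1, ?_⟩
    have hd : Disjoint P N := by
      rw [Submodule.disjoint_def]
      intro x hxP hxN
      refine hnd x fun y => ?_
      have hy : y ∈ P ⊔ N := h1.1 ▸ Submodule.mem_top
      obtain ⟨a, ha, c, hc, rfl⟩ := Submodule.mem_sup.1 hy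
      rw [map_add, h1.2.1 x hxP c hc, hs, h1.2.1 a ha x hxN, add_zero]
    have := finrank_sup_of_disj hd
    rw [h1.1, finrank_top] at this
    rw [Nat.even_iff]
    omega
  · exact h
end LA5
end Stmt15

namespace Stmt15
open Module CliffordAlgebra

section CL1
variable {F : Type*} [Field F] {V : Type*} [AddCommGroup V] [Module F V]
  {Q : QuadraticForm F V}

/-- orthonormal lists -/
def ON (Q : QuadraticForm F V) (l : List V) : Prop :=
  l.Pairwise (fun x y => QuadraticMap.polar Q x y = 0) ∧ ∀ e ∈ l, Q e = 1

theorem ON.tail {e : V} {l : List V} (h : ON Q (e :: l)) : ON Q l :=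
  ⟨(List.pairwise_cons.1 h.1).2, fun x hx => h.2 x (List.mem_cons_of_mem _ hx)⟩

theorem ON.head {e : V} {l : List V} (h : ON Q (e :: l)) :
    Q e = 1 ∧ ∀ x ∈ l, QuadraticMap.polar Q e x = 0 :=
  ⟨h.2 e (by simp), (List.pairwise_cons.1 h.1).1⟩

theorem anti {x y : V} (h : QuadraticMap.polar Q x y = 0) : ι Q x * ι Q y = -(ι Q y * ι Q x) := by
  have := ι_mul_ι_add_swap (Q := Q) x y
  rw [h, map_zero] at this
  exact eq_neg_of_add_eq_zero_left this

theorem sq_one {x : V} (h : Q x = 1) : ι Q x * ι Q x = 1 := by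
  rw [ι_sq_scalar, h, map_one]

/-- The span of the words in a list of vectors. -/
def DD (Q : QuadraticForm F V) : List V → Submodule F (CliffordAlgebra Q)
  | [] => Submodule.span F {1}
  | e :: l => DD Q l ⊔ (DD Q l).map (LinearMap.mulLeft F (ι Q e))

theorem mem_DD_cons {e : V} {l : List V} {x : CliffordAlgebra Q} :
    x ∈ DD Q (e :: l) ↔ ∃ a ∈ DD Q l, ∃ b ∈ DD Q l, a + ι Q e * b = x := by
  rw [DD, Submodule.mem_sup]
  constructor
  · rintro ⟨a, ha, _, ⟨b, hb, rfl⟩, rfl⟩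
    exact ⟨a, ha, b, hb, rfl⟩
  · rintro ⟨a, ha, b, hb, rfl⟩
    exact ⟨a, ha, _, ⟨b, hb, rfl⟩, rfl⟩

theorem DD_one (l : List V) : (1 : CliffordAlgebra Q) ∈ DD Q l := by
  induction l with
  | nil => exact Submodule.mem_span_singleton_self 1
  | cons e l ih => exact Submodule.mem_sup_left ih

theorem DD_fin (l : List V) : FiniteDimensional F (DD Q l) := by
  induction l with
  | nil => rw [DD]; infer_instance
  | cons e l ih => rw [DD]; infer_instance

theorem DD_swap {l : List V} {v : V} (hv : ∀ x ∈ l, QuadraticMap.polar Q v x = 0) :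
    ∀ a ∈ DD Q l, ι Q v * a = involute a * ι Q v := by
  induction l with
  | nil =>
    intro a ha
    obtain ⟨c, rfl⟩ := Submodule.mem_span_singleton.1 ha
    simp
  | cons e l ih =>
    intro x hx
    obtain ⟨a, ha, b, hb, rfl⟩ := mem_DD_cons.1 hx
    have ih := ih (fun x hx => hv x (by simp [hx]))
    rw [mul_add, ih a ha, map_add, add_mul, map_mul, involute_ι, ← mul_assoc,
      anti (hv e (by simp)), neg_mul, mul_assoc, ih b hb]
    simp [mul_assoc]

theorem DD_mul {l : List V} (hl : ON Q l) : ∀ v ∈ l, ∀ a ∈ DD Q l, ι Q v * a ∈ DD Q l := by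
  induction l with
  | nil => simp
  | cons e l ih =>
    intro v hv x hx
    obtain ⟨a, ha, b, hb, rfl⟩ := mem_DD_cons.1 hx
    rcases List.mem_cons.1 hv with rfl | hv
    · refine mem_DD_cons.2 ⟨b, hb, a, ha, ?_⟩
      rw [mul_add, ← mul_assoc, sq_one hl.head.1, one_mul, add_comm]
    · refine mem_DD_cons.2 ⟨_, ih hl.tail v hv a ha, _, Submodule.neg_mem _ (ih hl.tail v hv b hb), ?_⟩
      have : QuadraticMap.polar Q v e = 0 := by
        rw [QuadraticMap.polar_comm]; exact hl.head.2 v hv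
      rw [mul_add, ← mul_assoc (ι Q v) (ι Q e), anti this]
      simp [mul_assoc]

theorem DD_top {l : List V} (hl : ON Q l) (hsp : Submodule.span F {x | x ∈ l} = ⊤) :
    DD Q l = ⊤ := by
  rw [eq_top_iff]
  rintro x -
  induction x using CliffordAlgebra.left_induction with
  | algebraMap r => rw [Algebra.algebraMap_eq_smul_one]; exact Submodule.smul_mem _ _ (DD_one l)
  | add x y hx hy => exact Submodule.add_mem _ hx hy
  | ι_mul x v hx =>
    have hv : v ∈ Submodule.span F {x | x ∈ l} := hsp ▸ Submodule.mem_top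
    induction hv using Submodule.span_induction with
    | mem v hv => exact DD_mul hl v hv x hx
    | zero => simp
    | add a b _ _ ha hb => rw [map_add, add_mul]; exact Submodule.add_mem _ ha hb
    | smul c a _ ha => rw [map_smul, smul_mul_assoc]; exact Submodule.smul_mem _ _ ha

theorem DD_kernel [NeZero (2 : F)] {l : List V} (hl : ON Q l) :
    ∀ x ∈ DD Q l, (∀ v ∈ l, ι Q v * x = involute x * ι Q v) → ∃ c : F, x = algebraMap F _ c := by
  induction l with
  | nil =>
    intro x hx _
    obtain ⟨c, rfl⟩ := Submodule.mem_span_singleton.1 hx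
    exact ⟨c, by rw [Algebra.algebraMap_eq_smul_one]⟩
  | cons e l ih =>
    intro x hx h
    obtain ⟨a, ha, b, hb, rfl⟩ := mem_DD_cons.1 hx
    have h1 := h e (by simp)
    have ea := DD_swap hl.head.2 a ha
    have eb := DD_swap hl.head.2 b hb
    have h2 : b + b = 0 := by
      rw [mul_add, map_add, add_mul, ea, map_mul, involute_ι, ← mul_assoc, sq_one hl.head.1,
        mul_assoc, ← eb, ← mul_assoc, neg_mul, sq_one hl.head.1] at h1
      have := add_left_cancel h1
      rw [one_mul, neg_mul, one_mul] at this
      nth_rewrite 1 [this]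
      simp
    have h3 : b = 0 := by
      rw [← two_smul F, smul_eq_zero] at h2
      exact h2.resolve_left (NeZero.ne 2)
    subst h3
    rw [mul_zero, add_zero] at h ⊢
    exact ih hl.tail a ha fun v hv => h v (by simp [hv])

/-- The product of a list of vectors in the Clifford algebra. -/
abbrev pr (Q : QuadraticForm F V) (l : List V) : CliffordAlgebra Q := (l.map (ι Q)).prod

theorem pr_DD (l : List V) : pr Q l ∈ DD Q l := by
  induction l with
  | nil => exact DD_one _
  | cons e l ih =>
    refine mem_DD_cons.2 ⟨0, Submodule.zero_mem _, _, ih, ?_⟩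
    simp [pr]

theorem pr_swap {l : List V} {v : V} (hv : ∀ x ∈ l, QuadraticMap.polar Q v x = 0) :
    ι Q v * pr Q l = involute (pr Q l) * ι Q v := DD_swap hv _ (pr_DD l)

theorem pr_swap_mem {l : List V} (hl : ON Q l) {v : V} (hv : v ∈ l) :
    ι Q v * pr Q l = - involute (pr Q l) * ι Q v := by
  induction l with
  | nil => simp at hv
  | cons e l ih =>
    rw [pr, List.map_cons, List.prod_cons, map_mul, involute_ι]
    rcases List.mem_cons.1 hv with rfl | hv
    · rw [neg_mul, neg_mul, neg_mul, neg_neg, mul_assoc _ (involute _), ← pr_swap hl.head.2]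
    · have : QuadraticMap.polar Q v e = 0 := by
        rw [QuadraticMap.polar_comm]; exact hl.head.2 v hv
      have ih := ih hl.tail hv
      rw [← mul_assoc, anti this, neg_mul, mul_assoc, ih]
      simp [mul_assoc]

theorem pr_swap_span {l : List V} (hl : ON Q l) {v : V} (hv : v ∈ Submodule.span F {x | x ∈ l}) :
    ι Q v * pr Q l = - involute (pr Q l) * ι Q v := by
  induction hv using Submodule.span_induction with
  | mem v hv => exact pr_swap_mem hl hv
  | zero => simp
  | add a b _ _ ha hb => rw [map_add, add_mul, mul_add, ha, hb]
  | smul c a _ ha => rw [map_smul, smul_mul_assoc, mul_smul_comm, ha]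

theorem rev_mul_pr {l : List V} (hl : ∀ e ∈ l, Q e = 1) : reverse (pr Q l) * pr Q l = 1 := by
  induction l with
  | nil => simp [pr]
  | cons e l ih =>
    rw [pr, List.map_cons, List.prod_cons, reverse.map_mul, reverse_ι, mul_assoc,
      ← mul_assoc (ι Q e), sq_one (hl e (by simp)), one_mul, ih (fun x hx => hl x (by simp [hx]))]

theorem pr_mul_rev {l : List V} (hl : ∀ e ∈ l, Q e = 1) : pr Q l * reverse (pr Q l) = 1 := by
  induction l with
  | nil => simp [pr]
  | cons e l ih =>
    rw [pr, List.map_cons, List.prod_cons, reverse.map_mul, reverse_ι, mul_assoc,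
      ← mul_assoc _ _ (ι Q e), ih (fun x hx => hl x (by simp [hx])), one_mul,
      sq_one (hl e (by simp))]

theorem pr_parity (l : List V) : pr Q l ∈ evenOdd Q (l.length : ZMod 2) := by
  induction l with
  | nil => simpa [pr] using one_le_evenOdd_zero Q
  | cons e l ih =>
    rw [pr, List.map_cons, List.prod_cons, List.length_cons, Nat.cast_succ, add_comm]
    exact evenOdd_mul_le Q _ _ (Submodule.mul_mem_mul (ι_mem_evenOdd_one Q e) ih)

theorem inv_pr (l : List V) : involute (pr Q l) = pr Q l ∨ involute (pr Q l) = - pr Q l := by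
  rw [involute_prod_map_ι]
  rcases neg_one_pow_eq_or F l.length with h | h <;> simp [h]

theorem rev_pr {l : List V} (hl : ON Q l) :
    reverse (pr Q l) = pr Q l ∨ reverse (pr Q l) = - pr Q l := by
  induction l with
  | nil => simp [pr]
  | cons e l ih =>
    rw [pr, List.map_cons, List.prod_cons, reverse.map_mul, reverse_ι, pr_swap hl.head.2]
    rcases ih hl.tail with h | h <;> rcases inv_pr (Q := Q) l with h' | h' <;> simp [h, h']

theorem pr_sq {l : List V} (hl : ON Q l) : pr Q l * pr Q l = 1 ∨ pr Q l * pr Q l = -1 := by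
  have := rev_mul_pr hl.2
  rcases rev_pr hl with h | h
  · rw [h] at this; exact Or.inl this
  · rw [h, neg_mul] at this; right; rw [← this, neg_neg]

/-- the unit -/
def prU {l : List V} (hl : ∀ e ∈ l, Q e = 1) : (CliffordAlgebra Q)ˣ :=
  ⟨pr Q l, reverse (pr Q l), pr_mul_rev hl, rev_mul_pr hl⟩

theorem prU_lip {l : List V} (hl : ∀ e ∈ l, Q e = 1) : prU hl ∈ lipschitzGroup Q := by
  induction l with
  | nil =>
    have : prU hl = 1 := by ext; simp [prU, pr]
    rw [this]; exact one_mem _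
  | cons e l ih =>
    have hl' : ∀ e ∈ l, Q e = 1 := fun x hx => hl x (by simp [hx])
    have he : ∀ x ∈ [e], Q x = 1 := fun x hx => hl x (by simp at hx; simp [hx])
    have : prU hl = prU he * prU hl' := by ext; simp [prU, pr]
    rw [this]
    refine mul_mem (Subgroup.subset_closure ⟨e, ?_⟩) (ih hl')
    simp [prU, pr]
end CL1

section exON
variable {F : Type*} [Field F] {V : Type*} [AddCommGroup V] [Module F V]
  {Q : QuadraticForm F V}
theorem exists_ON [IsAlgClosed F] [NeZero (2 : F)] [FiniteDimensional F V] {N : Submodule F V}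
    (hN : NDOn (QuadraticMap.polarBilin Q) N) :
    ∃ l, ON Q l ∧ Submodule.span F {x | x ∈ l} = N ∧ l.length = finrank F N := by
  have : Invertible (2 : F) := invertibleOfNonzero (NeZero.ne 2)
  obtain ⟨v, hv⟩ := LinearMap.BilinForm.exists_orthogonal_basis
    (B := LinearMap.BilinForm.restrict (QuadraticMap.polarBilin Q) N)
    ⟨fun x y => QuadraticMap.polar_comm Q x y⟩
  have hv0 : ∀ i, QuadraticMap.polarBilin Q (v i) (v i) ≠ 0 := fun i =>
    hv.not_isOrtho_basis_self_of_separatingLeft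
      (fun x h => Subtype.ext (hN x x.2 fun y hy => h ⟨y, hy⟩)) i
  have hQ0 : ∀ i, Q (v i) ≠ 0 := by
    intro i h
    apply hv0 i
    rw [QuadraticMap.polarBilin_apply_apply, QuadraticMap.polar_self, h, smul_zero]
  have hc : ∀ i, ∃ c : F, c ≠ 0 ∧ c * c * Q (v i) = 1 := by
    intro i
    obtain ⟨z, hz⟩ := IsAlgClosed.exists_pow_nat_eq (Q (v i))⁻¹ (n := 2) (by norm_num)
    refine ⟨z, ?_, ?_⟩
    · rintro rfl
      simp [eq_comm] at hz
      exact hQ0 i hz.symm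
    · rw [← sq, hz, inv_mul_cancel₀ (hQ0 i)]
  choose c hc0 hc using hc
  refine ⟨List.ofFn fun i => c i • (v i : V), ⟨?_, ?_⟩, ?_, by simp⟩
  · rw [List.pairwise_ofFn]
    intro i j hij
    have := hv (ne_of_lt hij)
    have h : QuadraticMap.polar Q (v i) (v j) = 0 := this
    rw [QuadraticMap.polar_smul_left, QuadraticMap.polar_smul_right, h, smul_zero, smul_zero]
  · intro e he
    obtain ⟨i, rfl⟩ := (List.mem_ofFn' _ _).1 he
    rw [QuadraticMap.map_smul, smul_eq_mul, hc]
  · apply le_antisymm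
    · rw [Submodule.span_le]
      intro e he
      obtain ⟨i, rfl⟩ := (List.mem_ofFn' _ _).1 he
      exact N.smul_mem _ (v i).2
    · have : N = (Submodule.span F (Set.range v)).map N.subtype := by
        rw [v.span_eq, Submodule.map_top, Submodule.range_subtype]
      refine this.le.trans ?_
      rw [Submodule.map_span, Submodule.span_le]
      rintro _ ⟨_, ⟨i, rfl⟩, rfl⟩
      have : N.subtype (v i) = (c i)⁻¹ • (c i • (v i : V)) := by
        rw [smul_smul, inv_mul_cancel₀ (hc0 i), one_smul]; rfl
      rw [this]
      exact Submodule.smul_mem _ _ (Submodule.subset_span ((List.mem_ofFn' _ _).2 ⟨i, rfl⟩))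
end exON
end Stmt15

namespace Stmt15
open Module CliffordAlgebra

section CL2
variable {F : Type*} [Field F] {V : Type*} [AddCommGroup V] [Module F V]
  {Q : QuadraticForm F V}

theorem spin_mul {x y : (CliffordAlgebra Q)ˣ} (hx : IsSpinElt Q x) (hy : IsSpinElt Q y) :
    IsSpinElt Q (x * y) := by
  refine ⟨mul_mem hx.1 hy.1, ?_, ?_⟩
  · have := evenOdd_mul_le Q _ _ (Submodule.mul_mem_mul hx.2.1 hy.2.1)
    simpa using this
  · rw [Units.val_mul, reverse.map_mul, mul_assoc, ← mul_assoc (reverse (x : CliffordAlgebra Q)),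
      hx.2.2, one_mul, hy.2.2]

theorem spin_inv_val {x : (CliffordAlgebra Q)ˣ} (hx : IsSpinElt Q x) :
    ((x⁻¹ : (CliffordAlgebra Q)ˣ) : CliffordAlgebra Q) = reverse (x : CliffordAlgebra Q) :=
  Units.inv_eq_of_mul_eq_one_left hx.2.2

theorem spin_inv {x : (CliffordAlgebra Q)ˣ} (hx : IsSpinElt Q x) : IsSpinElt Q x⁻¹ := by
  refine ⟨inv_mem hx.1, ?_, ?_⟩
  · rw [spin_inv_val hx, reverse_mem_evenOdd_iff]; exact hx.2.1
  · rw [spin_inv_val hx, reverse_reverse, ← spin_inv_val hx, Units.mul_inv]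

theorem prU_spin {l : List V} (hl : ON Q l) (he : Even l.length) : IsSpinElt Q (prU hl.2) := by
  refine ⟨prU_lip hl.2, ?_, rev_mul_pr hl.2⟩
  have := pr_parity (Q := Q) l
  rwa [(ZMod.natCast_eq_zero_iff_even).2 he] at this

theorem kernel [IsAlgClosed F] [NeZero (2 : F)] [FiniteDimensional F V]
    (hnd : ∀ x, (∀ y, QuadraticMap.polarBilin Q x y = 0) → x = 0) {x : CliffordAlgebra Q}
    (h : ∀ v, ι Q v * x = involute x * ι Q v) : ∃ c : F, x = algebraMap F _ c := by
  obtain ⟨l, hl, hsp, -⟩ := exists_ON (Q := Q) (N := ⊤) (fun x _ h => hnd x fun y => h y trivial)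
  exact DD_kernel hl x (DD_top hl hsp ▸ Submodule.mem_top) fun v _ => h v

theorem finDimC [IsAlgClosed F] [NeZero (2 : F)] [FiniteDimensional F V]
    (hnd : ∀ x, (∀ y, QuadraticMap.polarBilin Q x y = 0) → x = 0) :
    FiniteDimensional F (CliffordAlgebra Q) := by
  obtain ⟨l, hl, hsp, -⟩ := exists_ON (Q := Q) (N := ⊤) (fun x _ h => hnd x fun y => h y trivial)
  have := DD_fin (Q := Q) l
  rw [DD_top hl hsp] at this
  exact Module.Finite.equiv (Submodule.topEquiv (R := F) (M := CliffordAlgebra Q))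

theorem algInj [NeZero (2 : F)] : Function.Injective (algebraMap F (CliffordAlgebra Q)) :=
  have : Invertible (2 : F) := invertibleOfNonzero (NeZero.ne 2)
  (algebraMap F (CliffordAlgebra Q)).injective

/-- an even element of norm one commuting with all vectors is `±1` -/
theorem even_central [IsAlgClosed F] [NeZero (2 : F)] [FiniteDimensional F V]
    (hnd : ∀ x, (∀ y, QuadraticMap.polarBilin Q x y = 0) → x = 0) {x : (CliffordAlgebra Q)ˣ}
    (hx : IsSpinElt Q x) (h : ∀ v, Commute (x : CliffordAlgebra Q) (ι Q v)) : x = 1 ∨ x = -1 := by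
  obtain ⟨c, hc⟩ := kernel hnd (x := (x : CliffordAlgebra Q)) (fun v => by
    rw [involute_eq_of_mem_even hx.2.1]; exact (h v).symm)
  have h1 := hx.2.2
  rw [hc, reverse.commutes, ← map_mul, ← map_one (algebraMap F _)] at h1
  rcases mul_self_eq_one_iff.1 (algInj h1) with h | h
  · left; ext; rw [hc, h]; simp
  · right; ext; rw [hc, h]; simp

theorem ι_inj [NeZero (2 : F)]
    (hnd : ∀ x, (∀ y, QuadraticMap.polarBilin Q x y = 0) → x = 0) :
    Function.Injective (ι Q) := by
  rw [injective_iff_map_eq_zero]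
  intro v hv
  refine hnd v fun w => algInj (Q := Q) ?_
  rw [QuadraticMap.polarBilin_apply_apply, ← ι_mul_ι_add_swap, hv]
  simp

theorem exists_Ad [NeZero (2 : F)]
    (hnd : ∀ x, (∀ y, QuadraticMap.polarBilin Q x y = 0) → x = 0)
    {t : (CliffordAlgebra Q)ˣ} (ht : t ∈ lipschitzGroup Q) :
    ∃ g : V →ₗ[F] V, ∀ v, SemiconjBy (t : CliffordAlgebra Q) (ι Q v) (ι Q (g v)) := by
  have : Invertible (2 : F) := invertibleOfNonzero (NeZero.ne 2)
  obtain ⟨r, hr⟩ := LinearMap.exists_leftInverse_of_injective (ι Q)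
    (LinearMap.ker_eq_bot.2 (ι_inj hnd))
  let g : V →ₗ[F] V := r ∘ₗ LinearMap.mulLeft F (t : CliffordAlgebra Q) ∘ₗ
    LinearMap.mulRight F ((t⁻¹ : (CliffordAlgebra Q)ˣ) : CliffordAlgebra Q) ∘ₗ ι Q
  refine ⟨g, fun v => ?_⟩
  obtain ⟨w, hw⟩ := lipschitzGroup.conjAct_smul_ι_mem_range_ι ht v
  rw [ConjAct.units_smul_def, ConjAct.ofConjAct_toConjAct] at hw
  have : g v = w := by
    change r (t * (ι Q v * _)) = w
    rw [← mul_assoc, ← hw]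
    exact LinearMap.congr_fun hr w
  rw [this, SemiconjBy, hw]
  simp

theorem exists_Ad' [NeZero (2 : F)]
    (hnd : ∀ x, (∀ y, QuadraticMap.polarBilin Q x y = 0) → x = 0)
    {t : (CliffordAlgebra Q)ˣ} (ht : t ∈ lipschitzGroup Q) :
    ∃ g g' : V →ₗ[F] V, g * g' = 1 ∧
      (∀ v, SemiconjBy (t : CliffordAlgebra Q) (ι Q v) (ι Q (g v))) ∧
      (∀ v, SemiconjBy (t : CliffordAlgebra Q) (ι Q (g' v)) (ι Q v)) ∧
      ∀ x y, QuadraticMap.polarBilin Q (g x) (g y) = QuadraticMap.polarBilin Q x y := by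
  have : Invertible (2 : F) := invertibleOfNonzero (NeZero.ne 2)
  obtain ⟨g, hg⟩ := exists_Ad hnd ht
  obtain ⟨g', hg'⟩ := exists_Ad hnd (inv_mem ht)
  have hg' := fun v => (hg' v).units_inv_symm_left
  rw [inv_inv] at hg'
  refine ⟨g, g', ?_, hg, hg', ?_⟩
  · ext v
    apply ι_inj hnd
    have h1 := hg (g' v)
    have h2 := hg' v
    rw [SemiconjBy] at h1 h2
    exact t.isUnit.mul_right_cancel (h1.symm.trans h2)
  · intro x y
    apply algInj (Q := Q)
    rw [QuadraticMap.polarBilin_apply_apply, QuadraticMap.polarBilin_apply_apply,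
      ← ι_mul_ι_add_swap, ← ι_mul_ι_add_swap]
    have h := ((hg x).mul_right (hg y)).add_right ((hg y).mul_right (hg x))
    rw [ι_mul_ι_add_swap x y, SemiconjBy, ← Algebra.commutes] at h
    rw [ι_mul_ι_add_swap x y]
    exact (t.isUnit.mul_right_cancel h).symm

theorem pol_symm (x y : V) : QuadraticMap.polarBilin Q x y = QuadraticMap.polarBilin Q y x :=
  QuadraticMap.polar_comm Q x y

theorem part1 [IsAlgClosed F] [NeZero (2 : F)] [FiniteDimensional F V]
    (hnd : ∀ x, (∀ y, QuadraticMap.polarBilin Q x y = 0) → x = 0)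
    (hdim : finrank F V % 4 = 0 ∨ finrank F V % 4 = 1 ∨ finrank F V % 4 = 3)
    {t : (CliffordAlgebra Q)ˣ} (ht : IsSpinElt Q t) :
    ∃ τ₁ τ₂ : (CliffordAlgebra Q)ˣ, IsSpinElt Q τ₁ ∧ IsSpinElt Q τ₂ ∧
          t = τ₁ * τ₂ ∧ (τ₁ ^ 2 = 1 ∨ τ₁ ^ 2 = -1) ∧ (τ₂ ^ 2 = 1 ∨ τ₂ ^ 2 = -1) := by
  obtain ⟨g, g', hgg', hg, hg', hiso⟩ := exists_Ad' hnd ht.1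
  obtain ⟨P, N, ⟨htop, ho, hP, hN⟩, heven⟩ := exists_even_PN pol_symm hnd hgg' hiso hdim
  have hNnd : NDOn (QuadraticMap.polarBilin Q) N := orth_nd' hnd
    (fun x hx m hm => by rw [pol_symm]; exact ho m hm x hx) htop
  obtain ⟨l, hl, hsp, hlen⟩ := exists_ON hNnd
  rw [← hlen] at heven
  have hτ := prU_spin hl heven
  have hinv : involute (pr Q l) = pr Q l := involute_eq_of_mem_even hτ.2.1
  set τ := prU hl.2 with hτdef
  have hτv : (τ : CliffordAlgebra Q) = pr Q l := rfl
  have cP : ∀ p ∈ P, SemiconjBy (τ : CliffordAlgebra Q) (ι Q p) (ι Q p) := by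
    intro p hp
    have := pr_swap (Q := Q) (l := l) (v := p) (fun x hx => ho p hp x
      (by rw [← hsp]; exact Submodule.subset_span hx))
    rw [hinv] at this
    exact this.symm
  have cN : ∀ p ∈ N, SemiconjBy (τ : CliffordAlgebra Q) (ι Q p) (-ι Q p) := by
    intro p hp
    have := pr_swap_span (Q := Q) hl (v := p) (by rwa [hsp])
    rw [hinv] at this
    rw [SemiconjBy, hτv, neg_mul, this, neg_mul, neg_neg]
  have h2 : (2 : F) ≠ 0 := NeZero.ne 2
  have e1 : ∀ v, g v = (2 : F)⁻¹ • ((g + g') v) + (2 : F)⁻¹ • ((g - g') v) := by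
    intro v
    rw [← smul_add, eq_inv_smul_iff₀ h2, LinearMap.add_apply, LinearMap.sub_apply]; module
  have e2 : ∀ v, g' v = (2 : F)⁻¹ • ((g + g') v) - (2 : F)⁻¹ • ((g - g') v) := by
    intro v
    rw [← smul_sub, eq_inv_smul_iff₀ h2, LinearMap.add_apply, LinearMap.sub_apply]; module
  have dP : ∀ p ∈ P, SemiconjBy (τ : CliffordAlgebra Q) (ι Q (g' p)) (ι Q (g p)) := by
    intro p hp
    have h1 := cP _ (P.smul_mem (2 : F)⁻¹ (hP p hp).2)
    have h2 := cN _ (N.smul_mem (2 : F)⁻¹ (hP p hp).1)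
    rw [e1, e2, map_sub, map_add]
    have := h1.sub_right h2
    rwa [sub_neg_eq_add] at this
  have dN : ∀ p ∈ N, SemiconjBy (τ : CliffordAlgebra Q) (ι Q (g' p)) (-ι Q (g p)) := by
    intro p hp
    have h1 := cN _ (N.smul_mem (2 : F)⁻¹ (hN p hp).2)
    have h2 := cP _ (P.smul_mem (2 : F)⁻¹ (hN p hp).1)
    rw [e1, e2, map_sub, map_add]
    have := h1.sub_right h2
    rwa [← neg_add'] at this
  have hτ2 : IsSpinElt Q (τ⁻¹ * t) := spin_mul (spin_inv hτ) ht
  refine ⟨τ, τ⁻¹ * t, hτ, hτ2, by simp, ?_, ?_⟩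
  · rcases pr_sq hl with h | h
    · left; ext; rw [sq]; exact h
    · right; ext; rw [sq]; exact h
  · rw [sq]
    refine even_central hnd (spin_mul hτ2 hτ2) fun v => ?_
    have hv : v ∈ P ⊔ N := htop ▸ Submodule.mem_top
    obtain ⟨p, hp, n, hn, rfl⟩ := Submodule.mem_sup.1 hv
    rw [map_add]
    refine Commute.add_right ?_ ?_
    · have h1 := (dP p hp).units_inv_symm_left.mul_left (hg p)
      have h2 := ((cP p hp).units_inv_symm_left).mul_left (hg' p)
      exact h2.mul_left h1
    · have h1 := (dN n hn).units_inv_symm_left.mul_left (hg n).neg_right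
      have h2 := ((cN n hn).units_inv_symm_left).mul_left (hg' n).neg_right
      have := h2.neg_right.mul_left h1.neg_right.neg_right
      rw [Commute]
      simpa using this
end CL2
end Stmt15

namespace Stmt15
open Module CliffordAlgebra

section CL3
variable {F : Type*} [Field F] {V : Type*} [AddCommGroup V] [Module F V]
  {Q : QuadraticForm F V}

/-- the vectors in a list of planes -/
def vecs : List (V × V × F × F) → List V
  | [] => []
  | p :: L => p.1 :: p.2.1 :: vecs L

/-- the element `α + β e f` of a plane -/
def tp (Q : QuadraticForm F V) (p : V × V × F × F) : CliffordAlgebra Q :=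
  p.2.2.1 • (1 : CliffordAlgebra Q) + p.2.2.2 • (ι Q p.1 * ι Q p.2.1)

/-- the product of the elements of the planes -/
def TT (Q : QuadraticForm F V) : List (V × V × F × F) → CliffordAlgebra Q
  | [] => 1
  | p :: L => tp Q p * TT Q L

theorem commute_two {v e f : V} (he : QuadraticMap.polar Q v e = 0)
    (hf : QuadraticMap.polar Q v f = 0) : Commute (ι Q e * ι Q f) (ι Q v) := by
  rw [Commute, SemiconjBy, mul_assoc, ← mul_assoc (ι Q v), anti he, neg_mul, mul_assoc (ι Q e),
    anti hf, mul_neg, neg_neg]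

theorem commute_tp {x : CliffordAlgebra Q} {p : V × V × F × F}
    (h : Commute (ι Q p.1 * ι Q p.2.1) x) : Commute (tp Q p) x :=
  Commute.add_left ((Commute.one_left x).smul_left _) (h.smul_left _)

theorem one_mem_even (Q : QuadraticForm F V) : (1 : CliffordAlgebra Q) ∈ evenOdd Q 0 :=
  one_le_evenOdd_zero Q (Submodule.one_le.1 le_rfl)

theorem tp_even (p : V × V × F × F) : tp Q p ∈ evenOdd Q 0 :=
  Submodule.add_mem _ (Submodule.smul_mem _ _ (one_mem_even Q))
    (Submodule.smul_mem _ _ (ι_mul_ι_mem_evenOdd_zero Q _ _))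

theorem TT_even (L : List (V × V × F × F)) : TT Q L ∈ evenOdd Q 0 := by
  induction L with
  | nil => exact one_mem_even Q
  | cons p L ih =>
    have := evenOdd_mul_le Q _ _ (Submodule.mul_mem_mul (tp_even (Q := Q) p) ih)
    rw [TT]
    simpa using this

theorem TT_comm {L : List (V × V × F × F)} {v : V}
    (h : ∀ x ∈ vecs L, QuadraticMap.polar Q v x = 0) : Commute (TT Q L) (ι Q v) := by
  induction L with
  | nil => exact Commute.one_left _
  | cons p L ih =>
    exact (commute_tp (commute_two (h _ (by simp [vecs])) (h _ (by simp [vecs])))).mul_left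
      (ih fun x hx => h x (by simp [vecs, hx]))

theorem vecs_head {p : V × V × F × F} {L : List (V × V × F × F)} (h : ON Q (vecs (p :: L))) :
    ON Q (vecs L) ∧ QuadraticMap.polar Q p.1 p.2.1 = 0 ∧ Q p.1 = 1 ∧ Q p.2.1 = 1 ∧
    (∀ x ∈ vecs L, QuadraticMap.polar Q p.1 x = 0) ∧
    (∀ x ∈ vecs L, QuadraticMap.polar Q p.2.1 x = 0) := by
  have h1 : ON Q (p.1 :: p.2.1 :: vecs L) := h
  exact ⟨h1.tail.tail, h1.head.2 _ (by simp), h1.head.1, h1.tail.head.1,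
    fun x hx => h1.head.2 x (by simp [hx]), h1.tail.head.2⟩

theorem tp_TT {p : V × V × F × F} {L : List (V × V × F × F)} (h : ON Q (vecs (p :: L))) :
    Commute (tp Q p) (TT Q L) := by
  obtain ⟨-, -, -, -, h1, h2⟩ := vecs_head h
  exact commute_tp ((TT_comm h1).symm.mul_left (TT_comm h2).symm)

theorem TT_semiconj {L : List (V × V × F × F)} {g : V → V} (h : ON Q (vecs L))
    (hg : ∀ p ∈ L, SemiconjBy (tp Q p) (ι Q p.1) (ι Q (g p.1)) ∧
      SemiconjBy (tp Q p) (ι Q p.2.1) (ι Q (g p.2.1))) :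
    ∀ v ∈ vecs L, SemiconjBy (TT Q L) (ι Q v) (ι Q (g v)) := by
  induction L with
  | nil => simp [vecs]
  | cons p L ih =>
    intro v hv
    obtain ⟨h0, -, -, -, h1, h2⟩ := vecs_head h
    have hc := tp_TT h
    rw [vecs, List.mem_cons, List.mem_cons] at hv
    rcases hv with rfl | rfl | hv
    · exact (hg p (by simp)).1.mul_left (TT_comm h1)
    · exact (hg p (by simp)).2.mul_left (TT_comm h2)
    · have h3 := ih h0 (fun q hq => hg q (by simp [hq])) v hv
      rw [TT, hc.eq]
      refine h3.mul_left (commute_tp (commute_two ?_ ?_))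
      · rw [QuadraticMap.polar_comm]; exact h1 v hv
      · rw [QuadraticMap.polar_comm]; exact h2 v hv

theorem ef_sq {e f : V} (h : QuadraticMap.polar Q e f = 0) (he : Q e = 1) (hf : Q f = 1) :
    (ι Q e * ι Q f) * (ι Q e * ι Q f) = -1 := by
  have : ι Q f * ι Q e = -(ι Q e * ι Q f) := by rw [anti h, neg_neg]
  rw [mul_assoc, ← mul_assoc (ι Q f), this, neg_mul, mul_assoc (ι Q e), sq_one hf, mul_one,
    mul_neg, sq_one he]

theorem rev_tp {p : V × V × F × F} (h : QuadraticMap.polar Q p.1 p.2.1 = 0) :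
    reverse (tp Q p) = p.2.2.1 • (1 : CliffordAlgebra Q) - p.2.2.2 • (ι Q p.1 * ι Q p.2.1) := by
  rw [tp, map_add, map_smul, map_smul, reverse.map_one, reverse.map_mul, reverse_ι, reverse_ι,
    ← neg_eq_iff_eq_neg.2 (anti h)]
  simp [sub_eq_add_neg]

theorem rev_tp_mul {p : V × V × F × F} (h : QuadraticMap.polar Q p.1 p.2.1 = 0)
    (he : Q p.1 = 1) (hf : Q p.2.1 = 1) (hab : p.2.2.1 * p.2.2.1 + p.2.2.2 * p.2.2.2 = 1) :
    reverse (tp Q p) * tp Q p = 1 ∧ tp Q p * reverse (tp Q p) = 1 := by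
  have := ef_sq h he hf
  rw [rev_tp h, tp]
  constructor
  · simp only [sub_mul, mul_add, smul_mul_smul_comm, this, mul_one, one_mul]
    refine Eq.trans ?_ (one_smul F (1 : CliffordAlgebra Q))
    rw [← hab]
    module
  · simp only [add_mul, mul_sub, smul_mul_smul_comm, this, mul_one, one_mul]
    refine Eq.trans ?_ (one_smul F (1 : CliffordAlgebra Q))
    rw [← hab]
    module

theorem rev_TT_mul {L : List (V × V × F × F)} (h : ON Q (vecs L))
    (hab : ∀ p ∈ L, p.2.2.1 * p.2.2.1 + p.2.2.2 * p.2.2.2 = 1) :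
    reverse (TT Q L) * TT Q L = 1 ∧ TT Q L * reverse (TT Q L) = 1 := by
  induction L with
  | nil => simp [TT]
  | cons p L ih =>
    obtain ⟨h0, h1, h2, h3, -, -⟩ := vecs_head h
    have h4 := rev_tp_mul h1 h2 h3 (hab p (by simp))
    have h5 := ih h0 (fun q hq => hab q (by simp [hq]))
    rw [TT, reverse.map_mul]
    constructor
    · rw [mul_assoc, ← mul_assoc _ (tp Q p), h4.1, one_mul, h5.1]
    · rw [mul_assoc, ← mul_assoc (TT Q L), h5.2, one_mul, h4.2]

theorem tp_flip {p : V × V × F × F} (h : QuadraticMap.polar Q p.1 p.2.1 = 0) :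
    ι Q p.1 * tp Q p = reverse (tp Q p) * ι Q p.1 := by
  rw [rev_tp h, tp, mul_add, sub_mul, mul_smul_comm, mul_smul_comm, smul_mul_assoc,
    smul_mul_assoc, mul_one, one_mul, mul_assoc (ι Q p.1) (ι Q p.2.1),
    ← neg_eq_iff_eq_neg.2 (anti h)]
  simp

theorem mem_vecs_fst {L : List (V × V × F × F)} {x : V} (hx : x ∈ L.map Prod.fst) :
    x ∈ vecs L := by
  induction L with
  | nil => simp at hx
  | cons p L ih =>
    rw [List.map_cons, List.mem_cons] at hx
    rcases hx with rfl | hx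
    · simp [vecs]
    · simp [vecs, ih hx]

theorem comm_pr {x : CliffordAlgebra Q} {l : List V} (h : ∀ v ∈ l, Commute x (ι Q v)) :
    Commute x (pr Q l) := by
  induction l with
  | nil => simp [pr]
  | cons e l ih =>
    rw [pr, List.map_cons, List.prod_cons]
    exact (h e (by simp)).mul_right (ih fun v hv => h v (by simp [hv]))

theorem comm_rev {x : CliffordAlgebra Q} {v : V} (h : Commute x (ι Q v)) :
    Commute (reverse x) (ι Q v) := by
  have := congrArg reverse h.eq
  rw [reverse.map_mul, reverse.map_mul, reverse_ι] at this
  exact this.symm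

theorem TT_flip {L : List (V × V × F × F)} (h : ON Q (vecs L)) :
    pr Q (L.map Prod.fst) * TT Q L = reverse (TT Q L) * pr Q (L.map Prod.fst) := by
  induction L with
  | nil => simp [TT, pr]
  | cons p L ih =>
    obtain ⟨h0, h1, -, -, h2, h3⟩ := vecs_head h
    have hc := tp_TT h
    have c1 : Commute (tp Q p) (pr Q (L.map Prod.fst)) := comm_pr fun v hv => by
      apply commute_tp
      apply commute_two
      · rw [QuadraticMap.polar_comm]; exact h2 v (mem_vecs_fst hv)
      · rw [QuadraticMap.polar_comm]; exact h3 v (mem_vecs_fst hv)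
    have c2 : Commute (reverse (TT Q L)) (ι Q p.1) := comm_rev (TT_comm h2)
    have ih := ih h0
    rw [TT, hc.eq, reverse.map_mul]
    rw [← hc.eq, pr, List.map_cons, List.map_cons, List.prod_cons]
    change ι Q p.1 * pr Q (L.map Prod.fst) * (tp Q p * TT Q L) =
      reverse (tp Q p) * reverse (TT Q L) * (ι Q p.1 * pr Q (L.map Prod.fst))
    rw [mul_assoc, ← mul_assoc (pr Q _), ← c1.eq, mul_assoc (tp Q p), ih, ← mul_assoc (ι Q p.1),
      tp_flip h1, mul_assoc, ← mul_assoc (ι Q p.1), ← c2.eq]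
    simp only [mul_assoc]

theorem vecs_length (L : List (V × V × F × F)) : (vecs L).length = 2 * L.length := by
  induction L with
  | nil => rfl
  | cons p L ih => rw [vecs, List.length_cons, List.length_cons, ih, List.length_cons]; ring

/-- trace of left multiplication -/
noncomputable def trc (Q : QuadraticForm F V) : CliffordAlgebra Q →ₗ[F] F :=
  LinearMap.trace F (CliffordAlgebra Q) ∘ₗ (LinearMap.mul F (CliffordAlgebra Q))

theorem trc_comm (x y : CliffordAlgebra Q) : trc Q (x * y) = trc Q (y * x) := by
  have : ∀ x y : CliffordAlgebra Q, LinearMap.mul F (CliffordAlgebra Q) (x * y) =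
      LinearMap.mul F (CliffordAlgebra Q) x * LinearMap.mul F (CliffordAlgebra Q) y := by
    intro x y; ext z; simp [mul_assoc]
  rw [trc, LinearMap.comp_apply, LinearMap.comp_apply, this, this, LinearMap.trace_mul_comm]

theorem trc_one [IsAlgClosed F] [NeZero (2 : F)] [FiniteDimensional F V] :
    trc Q (1 : CliffordAlgebra Q) ≠ 0 := by
  have : Invertible (2 : F) := invertibleOfNonzero (NeZero.ne 2)
  have b := (finBasis F V).ExteriorAlgebra.map (equivExterior Q).symm
  have : FiniteDimensional F (CliffordAlgebra Q) := Module.Finite.of_basis b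
  have hfr : finrank F (CliffordAlgebra Q) = 2 ^ finrank F V := by
    rw [finrank_eq_card_basis b]; simp
  have : trc Q (1 : CliffordAlgebra Q) = finrank F (CliffordAlgebra Q) := by
    rw [trc, LinearMap.comp_apply, ← LinearMap.trace_one]
    congr 1
    ext z; simp
  rw [this, hfr]
  push_cast
  exact pow_ne_zero _ (NeZero.ne 2)

theorem trc_zT [NeZero (2 : F)] {L : List (V × V × F × F)} (h : ON Q (vecs L))
    (hb : ∀ p ∈ L, p.2.2.2 ≠ 0) :
    ∃ c : F, c ≠ 0 ∧ trc Q (pr Q (vecs L) * TT Q L) = c * trc Q 1 := by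
  induction L with
  | nil => exact ⟨1, one_ne_zero, by simp [vecs, TT, pr]⟩
  | cons p L ih =>
    obtain ⟨h0, h1, h1e, h1f, h2, h3⟩ := vecs_head h
    obtain ⟨c, hc0, hc⟩ := ih h0 (fun q hq => hb q (by simp [hq]))
    refine ⟨-p.2.2.2 * c, mul_ne_zero (neg_ne_zero.2 (hb p (by simp))) hc0, ?_⟩
    have c1 : Commute (tp Q p) (pr Q (vecs L)) := comm_pr fun v hv => by
      apply commute_tp
      apply commute_two
      · rw [QuadraticMap.polar_comm]; exact h2 v hv
      · rw [QuadraticMap.polar_comm]; exact h3 v hv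
    have hev : involute (pr Q (vecs L)) = pr Q (vecs L) := by
      rw [involute_prod_map_ι, vecs_length, pow_mul]; simp
    have c2 : Commute (pr Q (vecs L) * TT Q L) (ι Q p.1) := by
      refine Commute.mul_left ?_ (TT_comm h2)
      have := pr_swap (Q := Q) h2
      rw [hev] at this
      exact this.symm
    set y := pr Q (vecs L) * TT Q L with hy
    have e1 : pr Q (vecs (p :: L)) * TT Q (p :: L) =
        p.2.2.1 • (ι Q p.1 * ι Q p.2.1 * y) - p.2.2.2 • y := by
      have : pr Q (vecs (p :: L)) = ι Q p.1 * ι Q p.2.1 * pr Q (vecs L) := by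
        simp [pr, vecs, mul_assoc]
      rw [this, TT, mul_assoc, ← mul_assoc (pr Q _), ← c1.eq, mul_assoc (tp Q p), ← hy, ← mul_assoc,
        tp, mul_add, mul_smul_comm, mul_smul_comm, ef_sq h1 h1e h1f, add_mul, smul_mul_assoc,
        smul_mul_assoc, mul_one]
      simp [sub_eq_add_neg]
    have e2 : trc Q (ι Q p.1 * ι Q p.2.1 * y) = 0 := by
      have h5 : trc Q (ι Q p.1 * ι Q p.2.1 * y) = - trc Q (ι Q p.1 * ι Q p.2.1 * y) := by
        conv_lhs => rw [mul_assoc, trc_comm, mul_assoc, c2.eq, ← mul_assoc]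
        rw [anti h1, neg_mul, map_neg, neg_neg]
      have h6 : (2 : F) * trc Q (ι Q p.1 * ι Q p.2.1 * y) = 0 := by
        rw [two_mul]; nth_rewrite 1 [h5]; simp
      exact (mul_eq_zero.1 h6).resolve_left (NeZero.ne 2)
    rw [e1, map_sub, map_smul, map_smul, e2, hc, smul_zero, zero_sub, smul_eq_mul]
    ring

theorem no_odd [IsAlgClosed F] [NeZero (2 : F)] [FiniteDimensional F V]
    {L : List (V × V × F × F)} (h : ON Q (vecs L))
    (hb : ∀ p ∈ L, p.2.2.2 ≠ 0) (hsp : Submodule.span F {x | x ∈ vecs L} = ⊤)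
    {u : (CliffordAlgebra Q)ˣ} (hu : (u : CliffordAlgebra Q) ∈ evenOdd Q 1)
    (hc : Commute (u : CliffordAlgebra Q) (TT Q L)) : False := by
  have hev : involute (pr Q (vecs L)) = pr Q (vecs L) := by
    rw [involute_prod_map_ι, vecs_length, pow_mul]; simp
  have hz : ∀ x : CliffordAlgebra Q, x * pr Q (vecs L) = pr Q (vecs L) * involute x := by
    intro x
    induction x using CliffordAlgebra.left_induction with
    | algebraMap r => simp [Algebra.commutes]
    | add x y hx hy => rw [add_mul, hx, hy, map_add, mul_add]
    | ι_mul x v hx =>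
      have := pr_swap_span h (v := v) (hsp ▸ Submodule.mem_top)
      rw [hev] at this
      rw [mul_assoc, hx, ← mul_assoc, this, map_mul, involute_ι]
      simp [mul_assoc]
  obtain ⟨c, hc0, hc1⟩ := trc_zT h hb
  have h5 : trc Q (pr Q (vecs L) * TT Q L) = - trc Q (pr Q (vecs L) * TT Q L) := by
    have e : (u : CliffordAlgebra Q) * (pr Q (vecs L) * TT Q L) =
        - (pr Q (vecs L) * TT Q L) * u := by
      rw [← mul_assoc, hz, involute_eq_of_mem_odd hu, mul_neg, neg_mul, mul_assoc, hc.eq]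
      simp [mul_assoc]
    have e2 : trc Q ((pr Q (vecs L) * TT Q L)) =
        trc Q (((u⁻¹ : (CliffordAlgebra Q)ˣ) : CliffordAlgebra Q) *
          ((u : CliffordAlgebra Q) * (pr Q (vecs L) * TT Q L))) := by simp
    conv_lhs => rw [e2, e, trc_comm]
    rw [mul_assoc]
    simp
  have h6 : (2 : F) * trc Q (pr Q (vecs L) * TT Q L) = 0 := by
    rw [two_mul]; nth_rewrite 1 [h5]; simp
  rw [hc1] at h6
  rcases mul_eq_zero.1 h6 with h | h
  · exact NeZero.ne 2 h
  · rcases mul_eq_zero.1 h with h | h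
    · exact hc0 h
    · exact trc_one h
end CL3
end Stmt15

namespace Stmt15
open Module CliffordAlgebra

section CL4
variable {F : Type*} [Field F] {V : Type*} [AddCommGroup V] [Module F V]
  {Q : QuadraticForm F V}

theorem aeval_transfer {W : Type*} [AddCommGroup W] [Module F W] (j : V →ₗ[F] W)
    (g : Module.End F V) (f : Module.End F W) (h : ∀ v, f (j v) = j (g v)) (p : Polynomial F) :
    ∀ v, Polynomial.aeval f p (j v) = j (Polynomial.aeval g p v) := by
  have hpow : ∀ (n : ℕ) v, (f ^ n) (j v) = j ((g ^ n) v) := by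
    intro n
    induction n with
    | zero => simp
    | succ n ih => intro v; rw [pow_succ, pow_succ, Module.End.mul_apply, h, ih, Module.End.mul_apply]
  intro v
  induction p using Polynomial.induction_on' with
  | add p q hp hq => simp [hp, hq]
  | monomial n a =>
    simp only [Polynomial.aeval_monomial, Module.algebraMap_end_eq_smul_id, Module.End.mul_apply, hpow,
      LinearMap.smul_apply, LinearMap.id_apply, map_smul]

theorem g_semisimple [IsAlgClosed F] [NeZero (2 : F)] [FiniteDimensional F V]
    (hnd : ∀ x, (∀ y, QuadraticMap.polarBilin Q x y = 0) → x = 0)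
    {t : (CliffordAlgebra Q)ˣ} (ht : IsSpinElt Q t)
    (hss : Module.End.IsSemisimple (LinearMap.mulLeft F (t : CliffordAlgebra Q)))
    {g : V →ₗ[F] V} (hg : ∀ v, SemiconjBy (t : CliffordAlgebra Q) (ι Q v) (ι Q (g v))) :
    Module.End.IsSemisimple g := by
  have := finDimC hnd
  have hr : Module.End.IsSemisimple
      (LinearMap.mulRight F ((t⁻¹ : (CliffordAlgebra Q)ˣ) : CliffordAlgebra Q)) := by
    refine (LinearEquiv.isSemisimple_iff (LinearMap.mulLeft F (t : CliffordAlgebra Q)) _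
      (LinearEquiv.ofInvolutive (reverse (Q := Q)) reverse_involutive) ?_).1 hss
    ext x
    simp [spin_inv_val ht, reverse.map_mul]
  have hm := Module.End.IsSemisimple.mul_of_commute
    (f := LinearMap.mulLeft F (t : CliffordAlgebra Q)) (g := LinearMap.mulRight F
      ((t⁻¹ : (CliffordAlgebra Q)ˣ) : CliffordAlgebra Q))
    (by ext x; simp [Module.End.mul_apply, mul_assoc]) hss hr
  refine Module.End.isSemisimple_of_squarefree_aeval_eq_zero hm.minpoly_squarefree ?_
  ext v
  apply ι_inj hnd
  rw [← aeval_transfer (ι Q) g _ ?_ _ v, minpoly.aeval]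
  · simp
  · intro v
    simp only [Module.End.mul_apply, LinearMap.mulRight_apply, LinearMap.mulLeft_apply]
    rw [← mul_assoc, (hg v).eq, mul_assoc, Units.mul_inv, mul_one]

theorem ON_nd {l : List V} [NeZero (2 : F)] (hl : ON Q l) :
    NDOn (QuadraticMap.polarBilin Q) (Submodule.span F {x | x ∈ l}) := by
  have h2 : (2 : F) ≠ 0 := NeZero.ne 2
  induction l with
  | nil => intro x hx _; simpa using hx
  | cons e l ih =>
    have : {x | x ∈ e :: l} = {e} ∪ {x | x ∈ l} := by ext; simp
    rw [this, Submodule.span_union]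
    refine NDOn.sup pol_symm ?_ (ih hl.tail) ?_
    · intro x hx h
      obtain ⟨c, rfl⟩ := Submodule.mem_span_singleton.1 hx
      have := h e (Submodule.mem_span_singleton_self e)
      have hc : c = 0 := by
        simpa [QuadraticMap.polar_self, hl.head.1, h2] using this
      simp [hc]
    · intro x hx y hy
      exact span_orth (fun a ha b hb => by
        rw [Set.mem_singleton_iff.1 ha]; exact hl.head.2 b hb) x hx y hy

theorem ON_length [FiniteDimensional F V] [NeZero (2 : F)] {l : List V} (hl : ON Q l) :
    l.length ≤ finrank F V := by
  have h2 : (2 : F) ≠ 0 := NeZero.ne 2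
  have : LinearIndependent F (fun i : Fin l.length => l[i]) := by
    refine LinearMap.linearIndependent_of_isOrthoᵢ (B := QuadraticMap.polarBilin Q) ?_ ?_
    · intro i j hij
      have hp := List.pairwise_iff_getElem.1 hl.1
      rcases lt_or_gt_of_ne hij with h | h
      · exact hp _ _ i.2 j.2 h
      · show QuadraticMap.polarBilin Q _ _ = 0
        rw [pol_symm]
        exact hp _ _ j.2 i.2 h
    · intro i h
      have := hl.2 l[i] (List.getElem_mem _)
      replace h : QuadraticMap.polarBilin Q l[i] l[i] = 0 := h
      rw [QuadraticMap.polarBilin_apply_apply, QuadraticMap.polar_self, this] at h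
      exact h2 (by simpa using h)
  simpa using this.fintype_card_le_finrank
end CL4
end Stmt15

namespace Stmt15
open Module CliffordAlgebra

section CL5
variable {F : Type*} [Field F] {V : Type*} [AddCommGroup V] [Module F V]
  {Q : QuadraticForm F V}

/-- a plane on which the isometry is given by `tp` -/
structure GoodP (Q : QuadraticForm F V) (g g' : V →ₗ[F] V) (p : V × V × F × F) : Prop where
  hab : p.2.2.1 * p.2.2.1 + p.2.2.2 * p.2.2.2 = 1
  hb : p.2.2.2 ≠ 0
  s1 : SemiconjBy (tp Q p) (ι Q p.1) (ι Q (g p.1))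
  s2 : SemiconjBy (tp Q p) (ι Q p.2.1) (ι Q (g p.2.1))
  m1 : g' p.1 ∈ Submodule.span F {p.1, p.2.1}
  m2 : g' p.2.1 ∈ Submodule.span F {p.1, p.2.1}

theorem neg_plane {g g' : V →ₗ[F] V} {e f : V}
    (hef : QuadraticMap.polar Q e f = 0) (ge : g e = -e) (gf : g f = -f)
    (ge' : g' e = -e) (gf' : g' f = -f) : GoodP Q g g' (e, f, 0, 1) := by
  have hfe : ι Q f * ι Q e = -(ι Q e * ι Q f) := by rw [anti hef, neg_neg]
  refine ⟨by simp, by simp, ?_, ?_, ?_, ?_⟩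
  · simp only [SemiconjBy, tp, ge, map_neg, zero_smul, zero_add, one_smul]
    rw [mul_assoc, hfe, neg_mul, mul_neg]
  · simp only [SemiconjBy, tp, gf, map_neg, zero_smul, zero_add, one_smul]
    rw [neg_mul, ← mul_assoc (ι Q f), hfe, neg_mul, neg_neg]
  · rw [ge']; exact Submodule.neg_mem _ (Submodule.subset_span (by simp))
  · rw [gf']; exact Submodule.neg_mem _ (Submodule.subset_span (by simp))

theorem hyp_plane [IsAlgClosed F] [NeZero (2 : F)] {g g' : V →ₗ[F] V} {x y : V} {μ ν : F}
    (hx : Q x = 0) (hy : Q y = 0)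
    (hxy : QuadraticMap.polar Q x y = 1) (gx : g x = μ • x) (gy : g y = ν • y)
    (gx' : g' x = ν • x) (gy' : g' y = μ • y) (hμν : μ * ν = 1) (hμ : μ ≠ 1) :
    ∃ p : V × V × F × F, GoodP Q g g' p ∧ Q p.1 = 1 ∧ Q p.2.1 = 1 ∧
      QuadraticMap.polar Q p.1 p.2.1 = 0 ∧ p.1 ∈ Submodule.span F {x, y} ∧
      p.2.1 ∈ Submodule.span F {x, y} := by
  have h2 : (2 : F) ≠ 0 := NeZero.ne 2
  obtain ⟨i, hi⟩ := IsAlgClosed.exists_pow_nat_eq (-1 : F) (n := 2) (by norm_num)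
  obtain ⟨ρ, hρ⟩ := IsAlgClosed.exists_pow_nat_eq ν (n := 2) (by norm_num)
  have hν0 : ν ≠ 0 := right_ne_zero_of_mul_eq_one hμν
  have hρ0 : ρ ≠ 0 := by rintro rfl; exact hν0 (by simpa using hρ.symm)
  have hi0 : i ≠ 0 := by rintro rfl; simp at hi
  have hx2 : ι Q x * ι Q x = 0 := by rw [ι_sq_scalar, hx, map_zero]
  have hy2 : ι Q y * ι Q y = 0 := by rw [ι_sq_scalar, hy, map_zero]
  have hyx : ι Q y * ι Q x = 1 - ι Q x * ι Q y := by
    rw [eq_sub_iff_add_eq, add_comm, ι_mul_ι_add_swap, hxy, map_one]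
  set α : F := (ρ + ρ⁻¹) / 2 with hα
  set β : F := (ρ - ρ⁻¹) / (2 * i) with hβ
  have hp : α + i * β = ρ := by rw [hα, hβ]; field_simp; ring
  have hm : α - i * β = ρ⁻¹ := by rw [hα, hβ]; field_simp; ring
  set T := tp Q (x + y, i • (x - y), α, β) with hT
  have hTe : T = α • 1 + (β * i) • (1 - (2 : F) • (ι Q x * ι Q y)) := by
    rw [hT, tp]
    simp only [map_add, map_smul, map_sub, mul_smul_comm, add_mul, mul_sub, hx2, hy2, hyx, smul_smul]
    module
  have hxyx : ι Q x * ι Q y * ι Q x = ι Q x := by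
    rw [mul_assoc, hyx, mul_sub, mul_one, ← mul_assoc, hx2, zero_mul, sub_zero]
  have hyxy : ι Q y * (ι Q x * ι Q y) = ι Q y := by
    rw [← mul_assoc, hyx, sub_mul, one_mul, mul_assoc, hy2, mul_zero, sub_zero]
  have hxxy : ι Q x * (ι Q x * ι Q y) = 0 := by rw [← mul_assoc, hx2, zero_mul]
  have hxyy : ι Q x * ι Q y * ι Q y = 0 := by rw [mul_assoc, hy2, mul_zero]
  have a1 : T * ι Q x = ρ⁻¹ • ι Q x := by
    rw [hTe, ← hm]
    simp only [add_mul, sub_mul, smul_mul_assoc, one_mul, hxyx]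
    module
  have a2 : ι Q x * T = ρ • ι Q x := by
    rw [hTe, ← hp]
    simp only [mul_add, mul_sub, mul_smul_comm, mul_one, hxxy]
    module
  have a3 : T * ι Q y = ρ • ι Q y := by
    rw [hTe, ← hp]
    simp only [add_mul, sub_mul, smul_mul_assoc, one_mul, hxyy]
    module
  have a4 : ι Q y * T = ρ⁻¹ • ι Q y := by
    rw [hTe, ← hm]
    simp only [mul_add, mul_sub, mul_smul_comm, mul_one, hyxy]
    module
  have hμρ : μ * ρ = ρ⁻¹ := by
    refine eq_inv_of_mul_eq_one_left ?_
    rw [mul_assoc, ← sq, hρ, hμν]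
  have hνρ : ν * ρ⁻¹ = ρ := by rw [← hρ]; field_simp
  have sx : SemiconjBy T (ι Q x) (ι Q (g x)) := by
    rw [SemiconjBy, gx, map_smul, smul_mul_assoc, a1, a2, smul_smul, hμρ]
  have sy : SemiconjBy T (ι Q y) (ι Q (g y)) := by
    rw [SemiconjBy, gy, map_smul, smul_mul_assoc, a3, a4, smul_smul, hνρ]
  have hxx : QuadraticMap.polar Q x x = 0 := by rw [QuadraticMap.polar_self, hx, smul_zero]
  have hyy : QuadraticMap.polar Q y y = 0 := by rw [QuadraticMap.polar_self, hy, smul_zero]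
  have hyx' : QuadraticMap.polar Q y x = 1 := by rw [QuadraticMap.polar_comm, hxy]
  refine ⟨(x + y, i • (x - y), α, β), ⟨?_, ?_, ?_, ?_, ?_, ?_⟩, ?_, ?_, ?_, ?_, ?_⟩
  · show α * α + β * β = 1
    have : α * α + β * β = (α + i * β) * (α - i * β) := by linear_combination (β * β) * hi
    rw [this, hp, hm, mul_inv_cancel₀ hρ0]
  · show β ≠ 0
    intro h
    rw [h] at hp hm
    apply hμ
    have h1 : ρ = ρ⁻¹ := by rw [← hm, ← hp]; ring
    have : μ * ρ = ρ := by rw [hμρ, ← h1]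
    exact mul_right_cancel₀ hρ0 (by rw [this, one_mul])
  · show SemiconjBy T (ι Q (x + y)) (ι Q (g (x + y)))
    rw [map_add, map_add, map_add]
    exact sx.add_right sy
  · show SemiconjBy T (ι Q (i • (x - y))) (ι Q (g (i • (x - y))))
    rw [map_smul, map_smul, map_smul, map_sub, map_sub, map_sub]
    exact (sx.sub_right sy).smul_right i
  · show g' (x + y) ∈ Submodule.span F {x + y, i • (x - y)}
    rw [Submodule.mem_span_pair, map_add, gx', gy']
    refine ⟨(ν + μ) / 2, (ν - μ) / (2 * i), ?_⟩
    have : (ν - μ) / (2 * i) * i = (ν - μ) / 2 := by field_simp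
    rw [smul_smul, this]
    match_scalars <;> field_simp <;> ring
  · show g' (i • (x - y)) ∈ Submodule.span F {x + y, i • (x - y)}
    rw [Submodule.mem_span_pair, map_smul, map_sub, gx', gy']
    refine ⟨i * (ν - μ) / 2, (ν + μ) / 2, ?_⟩
    match_scalars <;> field_simp <;> ring
  · show Q (x + y) = 1
    rw [QuadraticMap.map_add Q, hx, hy, hxy]; simp
  · show Q (i • (x - y)) = 1
    rw [QuadraticMap.map_smul, sub_eq_add_neg, QuadraticMap.map_add Q, QuadraticMap.map_neg, hx, hy,
      QuadraticMap.polar_neg_right, hxy, ← sq, hi]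
    simp
  · show QuadraticMap.polar Q (x + y) (i • (x - y)) = 0
    rw [QuadraticMap.polar_smul_right, QuadraticMap.polar_sub_right, QuadraticMap.polar_add_left,
      QuadraticMap.polar_add_left, hxx, hyy, hxy, hyx']
    simp
  · exact Submodule.mem_span_pair.2 ⟨1, 1, by simp⟩
  · exact Submodule.mem_span_pair.2 ⟨i, -i, by simp [smul_sub, sub_eq_add_neg]⟩
end CL5
end Stmt15

namespace Stmt15
open Module CliffordAlgebra

section CL6
variable {F : Type*} [Field F] {V : Type*} [AddCommGroup V] [Module F V]
  {Q : QuadraticForm F V}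

theorem vecs_inv {g g' : V →ₗ[F] V} {L : List (V × V × F × F)} (h : ∀ p ∈ L, GoodP Q g g' p) :
    ∀ v ∈ vecs L, g' v ∈ Submodule.span F {x | x ∈ vecs L} := by
  induction L with
  | nil => simp [vecs]
  | cons p L ih =>
    intro v hv
    have hp := h p (by simp)
    have hle : Submodule.span F {p.1, p.2.1} ≤ Submodule.span F {x | x ∈ vecs (p :: L)} :=
      Submodule.span_mono (by
        rintro x (rfl | rfl)
        · simp [vecs]
        · simp [vecs])
    have hle2 : Submodule.span F {x | x ∈ vecs L} ≤ Submodule.span F {x | x ∈ vecs (p :: L)} :=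
      Submodule.span_mono (by
        intro x hx
        replace hx : x ∈ vecs L := hx
        simp [vecs, hx])
    rw [vecs, List.mem_cons, List.mem_cons] at hv
    rcases hv with rfl | rfl | hv
    · exact hle hp.m1
    · exact hle hp.m2
    · exact hle2 (ih (fun q hq => h q (by simp [hq])) v hv)

theorem span_eig [IsAlgClosed F] [FiniteDimensional F V] {g : Module.End F V}
    (hss : Module.End.IsSemisimple g) {R W : Submodule F V} (hR : ∀ x ∈ R, g x ∈ R)
    (h : ∀ μ : F, ∀ x ∈ R, g x = μ • x → x ∈ W) : R ≤ W := by
  have hr := Module.End.IsSemisimple.restrict (p := R) (f := g) hR hss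
  have ht := hr.iSup_eigenspace_eq_top
  intro r hrR
  have hmem : (⟨r, hrR⟩ : R) ∈ (⊤ : Submodule F R) := trivial
  rw [← ht] at hmem
  have hle : (⨆ μ, Module.End.eigenspace (LinearMap.restrict g hR) μ) ≤ W.comap R.subtype := by
    refine iSup_le fun μ z hz => ?_
    rw [Module.End.mem_eigenspace_iff] at hz
    exact h μ z z.2 (congrArg Subtype.val hz)
  exact hle hmem

theorem exists_max [FiniteDimensional F V] [NeZero (2 : F)] (g g' : V →ₗ[F] V) :
    ∃ L : List (V × V × F × F), ON Q (vecs L) ∧ (∀ p ∈ L, GoodP Q g g' p) ∧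
      ∀ p, GoodP Q g g' p → ¬ ON Q (vecs (p :: L)) := by
  by_contra hcon
  push Not at hcon
  have : ∀ n : ℕ, ∃ L : List (V × V × F × F), ON Q (vecs L) ∧ (∀ p ∈ L, GoodP Q g g' p) ∧
      L.length = n := by
    intro n
    induction n with
    | zero => exact ⟨[], ⟨by simp [vecs], by simp [vecs]⟩, by simp, rfl⟩
    | succ n ih =>
      obtain ⟨L, h1, h2, h3⟩ := ih
      obtain ⟨p, hp, hp'⟩ := hcon L h1 h2
      refine ⟨p :: L, hp', ?_, by simp [h3]⟩
      intro q hq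
      rcases List.mem_cons.1 hq with rfl | hq
      · exact hp
      · exact h2 q hq
  obtain ⟨L, h1, h2, h3⟩ := this (finrank F V + 1)
  have := ON_length h1
  rw [vecs_length] at this
  omega

theorem exists_decomp [IsAlgClosed F] [NeZero (2 : F)] [FiniteDimensional F V]
    (hnd : ∀ x, (∀ y, QuadraticMap.polarBilin Q x y = 0) → x = 0)
    {g g' : V →ₗ[F] V} (hgg' : g * g' = 1)
    (hiso : ∀ x y, QuadraticMap.polarBilin Q (g x) (g y) = QuadraticMap.polarBilin Q x y)
    (hss : Module.End.IsSemisimple g) :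
    ∃ (L : List (V × V × F × F)) (l₁ l₂ : List V), ON Q (vecs L ++ (l₁ ++ l₂)) ∧
      Submodule.span F {x | x ∈ vecs L ++ (l₁ ++ l₂)} = ⊤ ∧ (∀ p ∈ L, GoodP Q g g' p) ∧
      (∀ v ∈ l₁, g v = v) ∧ (∀ v ∈ l₂, g v = -v) ∧ l₂.length ≤ 1 := by
  have h2 : (2 : F) ≠ 0 := NeZero.ne 2
  have hg'g : g' * g = 1 := mul_eq_one_comm.1 hgg'
  have gg' : ∀ v, g (g' v) = v := fun v => LinearMap.congr_fun hgg' v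
  have g'g : ∀ v, g' (g v) = v := fun v => LinearMap.congr_fun hg'g v
  obtain ⟨L, hL, hgood, hmax⟩ := exists_max (Q := Q) g g'
  have hSnd := ON_nd hL
  obtain ⟨R, hR, htop, -⟩ := orth_compl pol_symm hSnd
  have hRnd := orth_nd pol_symm hnd hR htop
  have hRinv : ∀ x ∈ R, g x ∈ R := by
    intro x hx
    rw [hR]
    intro m hm
    have : g' m ∈ Submodule.span F {x | x ∈ vecs L} := span_maps (vecs_inv hgood) m hm
    rw [← gg' m, hiso]
    exact (hR x).1 hx _ this
  have hRv : ∀ x ∈ R, ∀ v ∈ vecs L, QuadraticMap.polar Q x v = 0 := by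
    intro x hx v hv
    rw [QuadraticMap.polar_comm]
    exact (hR x).1 hx v (Submodule.subset_span hv)
  have hext : ∀ p, GoodP Q g g' p → Q p.1 = 1 → Q p.2.1 = 1 →
      QuadraticMap.polar Q p.1 p.2.1 = 0 → p.1 ∈ R → p.2.1 ∈ R → False := by
    intro p hp h1 h2 h3 h4 h5
    refine hmax p hp ⟨?_, ?_⟩
    · rw [vecs, List.pairwise_cons, List.pairwise_cons]
      refine ⟨?_, hRv _ h5, hL.1⟩
      intro x hx
      rcases List.mem_cons.1 hx with rfl | hx
      · exact h3
      · exact hRv _ h4 x hx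
    · intro e he
      rw [vecs, List.mem_cons, List.mem_cons] at he
      rcases he with rfl | rfl | he
      · exact h1
      · exact h2
      · exact hL.2 e he
  have hQ0 : ∀ (x : V) (μ : F), g x = μ • x → μ ≠ 1 → μ ≠ -1 → Q x = 0 := by
    intro x μ hx h1 h3
    have := hiso x x
    rw [hx] at this
    simp only [map_smul, LinearMap.smul_apply, QuadraticMap.polarBilin_apply_apply,
      QuadraticMap.polar_self, smul_eq_mul, nsmul_eq_mul] at this
    have h4 : (μ - 1) * (μ + 1) * (2 * Q x) = 0 := by
      push_cast at this
      linear_combination this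
    simpa [sub_eq_zero, add_eq_zero_iff_eq_neg, h1, h3, h2] using h4
  have hinv : ∀ (x : V) (μ ν : F), g x = μ • x → μ * ν = 1 → g' x = ν • x := by
    intro x μ ν hx hμν
    rw [← g'g (ν • x), map_smul, hx, smul_smul, mul_comm, hμν, one_smul]
  have hM1 : ∀ (x : V) (μ : F), x ∈ R → g x = μ • x → μ ≠ 1 → μ ≠ -1 → x = 0 := by
    intro x μ hxR hx h1 h3
    by_contra hx0
    have : ∃ (ν : F) (y : V), y ∈ R ∧ g y = ν • y ∧ QuadraticMap.polarBilin Q x y ≠ 0 := by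
      by_contra hcon
      push Not at hcon
      apply hx0
      refine hRnd x hxR fun y hy => ?_
      exact span_eig (W := LinearMap.ker (QuadraticMap.polarBilin Q x)) hss hRinv
        (fun ν z hz hz' => hcon ν z hz hz') hy
    obtain ⟨ν, y, hyR, hy, hB⟩ := this
    have hμν : μ * ν = 1 := by
      have := hiso x y
      rw [hx, hy] at this
      simp only [map_smul, LinearMap.smul_apply, smul_eq_mul] at this
      apply mul_right_cancel₀ hB
      linear_combination this
    have hμ0 : μ ≠ 0 := left_ne_zero_of_mul_eq_one hμν
    have hν1 : ν ≠ 1 := by rintro rfl; exact h1 (by simpa using hμν)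
    have hν2 : ν ≠ -1 := by rintro rfl; exact h3 (by linear_combination -hμν)
    have hB' : QuadraticMap.polar Q x y ≠ 0 := hB
    obtain ⟨p, hp, p1, p2, p3, p4, p5⟩ := hyp_plane (Q := Q) (g := g) (g' := g') (x := x)
      (y := (QuadraticMap.polar Q x y)⁻¹ • y) (μ := μ) (ν := ν) (hQ0 x μ hx h1 h3)
      (by rw [QuadraticMap.map_smul, hQ0 y ν hy hν1 hν2, smul_zero])
      (by rw [QuadraticMap.polar_smul_right, smul_eq_mul, inv_mul_cancel₀ hB'])
      hx (by rw [map_smul, hy, smul_comm]) (hinv x μ ν hx hμν)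
      (by rw [map_smul, hinv y ν μ hy (by rw [mul_comm, hμν]), smul_comm]) hμν h1
    have hle : Submodule.span F {x, (QuadraticMap.polar Q x y)⁻¹ • y} ≤ R := by
      rw [Submodule.span_le]
      rintro z (rfl | rfl)
      · exact hxR
      · exact R.smul_mem _ hyR
    exact hext p hp p1 p2 p3 (hle p4) (hle p5)
  set R₁ := R ⊓ Module.End.eigenspace g 1 with hR₁
  set R₂ := R ⊓ Module.End.eigenspace g (-1) with hR₂
  have m₁ : ∀ x ∈ R₁, g x = x := fun x hx => by
    simpa using Module.End.mem_eigenspace_iff.1 hx.2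
  have m₂ : ∀ x ∈ R₂, g x = -x := fun x hx => by
    simpa using Module.End.mem_eigenspace_iff.1 hx.2
  have hRle : R ≤ R₁ ⊔ R₂ := by
    refine span_eig hss hRinv fun μ x hx hgx => ?_
    by_cases c1 : μ = 1
    · subst c1
      exact Submodule.mem_sup_left ⟨hx, Module.End.mem_eigenspace_iff.2 hgx⟩
    by_cases c2 : μ = -1
    · subst c2
      exact Submodule.mem_sup_right ⟨hx, Module.End.mem_eigenspace_iff.2 hgx⟩
    rw [hM1 x μ hx hgx c1 c2]
    exact Submodule.zero_mem _
  have ho : ∀ x ∈ R₁, ∀ y ∈ R₂, QuadraticMap.polarBilin Q x y = 0 := by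
    intro x hx y hy
    have := hiso x y
    rw [m₁ x hx, m₂ y hy, map_neg] at this
    have h5 : 2 * QuadraticMap.polarBilin Q x y = 0 := by linear_combination -this
    exact (mul_eq_zero.1 h5).resolve_left h2
  have nd₁ : NDOn (QuadraticMap.polarBilin Q) R₁ := by
    intro x hx h
    refine hRnd x hx.1 fun y hy => ?_
    obtain ⟨a, ha, b, hb, rfl⟩ := Submodule.mem_sup.1 (hRle hy)
    rw [map_add, h a ha, ho x hx b hb, add_zero]
  have nd₂ : NDOn (QuadraticMap.polarBilin Q) R₂ := by
    intro x hx h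
    refine hRnd x hx.1 fun y hy => ?_
    obtain ⟨a, ha, b, hb, rfl⟩ := Submodule.mem_sup.1 (hRle hy)
    rw [map_add, h b hb, pol_symm, ho a ha x hx, add_zero]
  obtain ⟨l₁, o₁, s₁, -⟩ := exists_ON nd₁
  obtain ⟨l₂, o₂, s₂, -⟩ := exists_ON nd₂
  have i₁ : ∀ v ∈ l₁, v ∈ R₁ := fun v hv => s₁ ▸ Submodule.subset_span hv
  have i₂ : ∀ v ∈ l₂, v ∈ R₂ := fun v hv => s₂ ▸ Submodule.subset_span hv
  refine ⟨L, l₁, l₂, ⟨?_, ?_⟩, ?_, hgood, fun v hv => m₁ v (i₁ v hv),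
    fun v hv => m₂ v (i₂ v hv), ?_⟩
  · rw [List.pairwise_append, List.pairwise_append]
    refine ⟨hL.1, ⟨o₁.1, o₂.1, fun a ha b hb => ho a (i₁ a ha) b (i₂ b hb)⟩, ?_⟩
    intro a ha b hb
    rw [QuadraticMap.polar_comm]
    rcases List.mem_append.1 hb with hb | hb
    · exact hRv b (i₁ b hb).1 a ha
    · exact hRv b (i₂ b hb).1 a ha
  · intro e he
    rcases List.mem_append.1 he with he | he
    · exact hL.2 e he
    rcases List.mem_append.1 he with he | he
    · exact o₁.2 e he
    · exact o₂.2 e he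
  · have : {x | x ∈ vecs L ++ (l₁ ++ l₂)} = {x | x ∈ vecs L} ∪ ({x | x ∈ l₁} ∪ {x | x ∈ l₂}) := by
      ext; simp
    rw [this, Submodule.span_union, Submodule.span_union, s₁, s₂, eq_top_iff, ← htop]
    exact sup_le_sup_left hRle _
  · match l₂, o₂, i₂ with
    | [], _, _ => simp
    | [_], _, _ => simp
    | e :: f :: l, o₂, i₂ =>
      exfalso
      have he := i₂ e (by simp)
      have hf := i₂ f (by simp)
      have ge := m₂ e he
      have gf := m₂ f hf
      have hef : QuadraticMap.polar Q e f = 0 := o₂.head.2 f (by simp)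
      refine hext (e, f, 0, 1) (neg_plane hef ge gf ?_ ?_) (o₂.2 e (by simp)) (o₂.2 f (by simp))
        hef he.1 hf.1
      · simpa using hinv e (-1) (-1) (by simpa using ge) (by simp)
      · simpa using hinv f (-1) (-1) (by simpa using gf) (by simp)
end CL6
end Stmt15

namespace Stmt15
open Module CliffordAlgebra

section CL7
variable {F : Type*} [Field F] {V : Type*} [AddCommGroup V] [Module F V]
  {Q : QuadraticForm F V}

theorem finish {t : (CliffordAlgebra Q)ˣ} (ht : IsSpinElt Q t) {l : List V} (hl : ON Q l)
    (he : Even l.length) (h : pr Q l * t = reverse (t : CliffordAlgebra Q) * pr Q l) :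
    ∃ τ₁ τ₂ : (CliffordAlgebra Q)ˣ, IsSpinElt Q τ₁ ∧ IsSpinElt Q τ₂ ∧
        t = τ₁ * τ₂ ∧ τ₁ ^ 2 = τ₂ ^ 2 ∧ (τ₁ ^ 2 = 1 ∨ τ₁ ^ 2 = -1) := by
  have hτ := prU_spin hl he
  set τ := prU hl.2 with hτdef
  have hc : τ * t = t⁻¹ * τ := by
    ext
    rw [Units.val_mul, Units.val_mul, spin_inv_val ht]
    exact h
  have hsq : τ ^ 2 = 1 ∨ τ ^ 2 = -1 := by
    rcases pr_sq hl with h | h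
    · left; ext; rw [sq]; exact h
    · right; ext; rw [sq]; exact h
  refine ⟨τ, τ⁻¹ * t, hτ, spin_mul (spin_inv hτ) ht, by simp, ?_, hsq⟩
  have h1 : t * τ⁻¹ = τ⁻¹ * t⁻¹ := by
    rw [mul_inv_eq_iff_eq_mul, mul_assoc, ← hc, inv_mul_cancel_left]
  have h2 : (τ⁻¹ * t) ^ 2 = (τ ^ 2)⁻¹ := by
    rw [sq, mul_assoc, ← mul_assoc t, h1]
    simp [sq]
  rw [h2]
  rcases hsq with h | h
  · rw [h, inv_one]
  · rw [h]; ext; simp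

theorem ON_fst {L : List (V × V × F × F)} (h : ON Q (vecs L)) : ON Q (L.map Prod.fst) := by
  induction L with
  | nil => exact ⟨by simp, by simp⟩
  | cons p L ih =>
    obtain ⟨h0, -, h2, -, h1, -⟩ := vecs_head h
    refine ⟨List.pairwise_cons.2 ⟨fun x hx => h1 x (mem_vecs_fst hx), (ih h0).1⟩, ?_⟩
    intro e he
    rw [List.map_cons] at he
    rcases List.mem_cons.1 he with rfl | he
    · exact h2
    · exact (ih h0).2 e he

theorem part2 [IsAlgClosed F] [NeZero (2 : F)] [FiniteDimensional F V]
    (hnd : ∀ x, (∀ y, QuadraticMap.polarBilin Q x y = 0) → x = 0)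
    {t : (CliffordAlgebra Q)ˣ} (ht : IsSpinElt Q t)
    (hss : Module.End.IsSemisimple (LinearMap.mulLeft F (t : CliffordAlgebra Q)))
    (hreal : ∃ s : (CliffordAlgebra Q)ˣ, IsSpinElt Q s ∧ s * t * s⁻¹ = t⁻¹) :
    ∃ τ₁ τ₂ : (CliffordAlgebra Q)ˣ, IsSpinElt Q τ₁ ∧ IsSpinElt Q τ₂ ∧
        t = τ₁ * τ₂ ∧ τ₁ ^ 2 = τ₂ ^ 2 ∧ (τ₁ ^ 2 = 1 ∨ τ₁ ^ 2 = -1) := by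
  have h2 : (2 : F) ≠ 0 := NeZero.ne 2
  have : Nontrivial (CliffordAlgebra Q) := (algInj (Q := Q)).nontrivial
  obtain ⟨g, g', hgg', hg, -, hiso⟩ := exists_Ad' hnd ht.1
  obtain ⟨L, l₁, l₂, hON, hsp, hgood, f₁, f₂, hlen⟩ :=
    exists_decomp hnd hgg' hiso (g_semisimple hnd ht hss hg)
  have hpa := List.pairwise_append.1 hON.1
  have hL : ON Q (vecs L) := ⟨hpa.1, fun e he => hON.2 e (by simp [he])⟩
  have hor : ∀ v ∈ l₁ ++ l₂, ∀ x ∈ vecs L, QuadraticMap.polar Q v x = 0 := by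
    intro v hv x hx
    rw [QuadraticMap.polar_comm]
    exact hpa.2.2 x hx v hv
  have hTr := rev_TT_mul hL fun p hp => (hgood p hp).hab
  set T : (CliffordAlgebra Q)ˣ := ⟨TT Q L, reverse (TT Q L), hTr.2, hTr.1⟩ with hT
  have hTi : ((T⁻¹ : (CliffordAlgebra Q)ˣ) : CliffordAlgebra Q) = reverse (TT Q L) := rfl
  have hTv : (T : CliffordAlgebra Q) = TT Q L := rfl
  have hTc : ∀ v ∈ l₁ ++ l₂, Commute (T : CliffordAlgebra Q) (ι Q v) := fun v hv =>
    TT_comm (hor v hv)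
  have hTs := TT_semiconj (g := g) hL fun p hp => ⟨(hgood p hp).s1, (hgood p hp).s2⟩
  set w := T⁻¹ * t with hw
  have weven : (w : CliffordAlgebra Q) ∈ evenOdd Q 0 := by
    have h3 : reverse (TT Q L) ∈ evenOdd Q 0 := by
      rw [reverse_mem_evenOdd_iff]; exact TT_even L
    have := evenOdd_mul_le Q _ _ (Submodule.mul_mem_mul h3 ht.2.1)
    simpa [hw, hTi] using this
  have winv := involute_eq_of_mem_even weven
  have wc0 : ∀ v ∈ vecs L, Commute (w : CliffordAlgebra Q) (ι Q v) := by
    intro v hv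
    have h3 : SemiconjBy (T : CliffordAlgebra Q) (ι Q v) (ι Q (g v)) := hTs v hv
    exact h3.units_inv_symm_left.mul_left (hg v)
  have wc1 : ∀ v ∈ l₁, Commute (w : CliffordAlgebra Q) (ι Q v) := by
    intro v hv
    have h3 := hg v
    rw [f₁ v hv] at h3
    exact (hTc v (by simp [hv])).units_inv_left.mul_left h3
  have wc2 : ∀ v ∈ l₂, SemiconjBy (w : CliffordAlgebra Q) (ι Q v) (-(ι Q v)) := by
    intro v hv
    have h3 := hg v
    rw [f₂ v hv, map_neg] at h3
    exact (SemiconjBy.neg_right (hTc v (by simp [hv])).units_inv_left).mul_left h3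
  have hDD := DD_top hON hsp
  have hl₂ : l₂ = [] := by
    match l₂, hlen, wc2, hON, hDD with
    | [], _, _, _, _ => rfl
    | [e], _, wc2, hON, hDD =>
      exfalso
      have wce := (wc2 e (by simp)).eq
      have hQe : Q e = 1 := hON.2 e (by simp)
      have hodd : ι Q e * (w : CliffordAlgebra Q) ∈ evenOdd Q 1 := by
        have := evenOdd_mul_le Q _ _ (Submodule.mul_mem_mul (ι_mem_evenOdd_one Q e) weven)
        simpa using this
      obtain ⟨c, hc⟩ := DD_kernel hON (ι Q e * (w : CliffordAlgebra Q)) (hDD ▸ Submodule.mem_top) (by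
        intro v hv
        rw [map_mul, involute_ι, winv]
        have hpe := hON.1
        rw [← List.append_assoc] at hpe hv
        rcases List.mem_append.1 hv with hv' | hv'
        · have h5 := anti ((List.pairwise_append.1 hpe).2.2 v hv' e (by simp))
          have h6 : Commute (w : CliffordAlgebra Q) (ι Q v) := by
            rcases List.mem_append.1 hv' with h | h
            · exact wc0 v h
            · exact wc1 v h
          rw [← mul_assoc, h5, neg_mul, neg_mul, neg_mul, mul_assoc, mul_assoc, h6.eq]
        · rw [List.mem_singleton.1 hv', mul_assoc, wce]
          simp)
      have h0 : algebraMap F (CliffordAlgebra Q) c ∈ evenOdd Q 0 := by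
        rw [Algebra.algebraMap_eq_smul_one]
        exact Submodule.smul_mem _ _ (one_mem_even Q)
      rw [← hc] at h0
      have hz := Submodule.disjoint_def.1 (evenOdd_isCompl Q).disjoint _ h0 hodd
      have h7 : ι Q e * (ι Q e * (w : CliffordAlgebra Q)) = w := by
        rw [← mul_assoc, sq_one hQe, one_mul]
      rw [hz, mul_zero] at h7
      exact w.ne_zero h7.symm
    | _ :: _ :: _, h, _, _, _ => simp at h
  subst hl₂
  rw [List.append_nil] at hON hsp hDD hor hTc
  obtain ⟨c, hc⟩ := DD_kernel hON (w : CliffordAlgebra Q) (hDD ▸ Submodule.mem_top) (by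
    intro v hv
    rw [winv]
    rcases List.mem_append.1 hv with h | h
    · exact (wc0 v h).symm.eq
    · exact (wc1 v h).symm.eq)
  have htT : (t : CliffordAlgebra Q) = c • TT Q L := by
    have h3 : t = T * w := by rw [hw, mul_inv_cancel_left]
    rw [h3, Units.val_mul, hc, Algebra.algebraMap_eq_smul_one, mul_smul_comm, mul_one]
  have hrt : reverse (t : CliffordAlgebra Q) = c • reverse (TT Q L) := by rw [htT, map_smul]
  have hc0 : c ≠ 0 := by
    rintro rfl
    rw [zero_smul] at htT
    exact t.ne_zero htT
  have hflip := TT_flip hL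
  have hfst := ON_fst hL
  rcases Nat.even_or_odd L.length with hev | hodd
  · refine finish ht hfst (by simpa using hev) ?_
    rw [htT, map_smul, mul_smul_comm, smul_mul_assoc, hflip]
  · match l₁, hor, hON, hTc, hsp with
    | r :: l, hor, hON, hTc, _ =>
      have hor' := hor r (by simp)
      refine finish ht (l := r :: L.map Prod.fst) ⟨List.pairwise_cons.2
        ⟨fun x hx => hor' x (mem_vecs_fst hx), hfst.1⟩, ?_⟩ ?_ ?_
      · intro e he
        rcases List.mem_cons.1 he with rfl | he
        · exact hON.2 e (by simp)
        · exact hfst.2 e he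
      · rw [List.length_cons, List.length_map]; exact hodd.add_one
      · have h3 : Commute (reverse (TT Q L)) (ι Q r) := comm_rev (hTc r (by simp))
        rw [htT, map_smul, mul_smul_comm, smul_mul_assoc, pr, List.map_cons, List.prod_cons,
          mul_assoc, hflip, ← mul_assoc, ← h3.eq, mul_assoc]
    | [], _, _, _, hsp =>
      exfalso
      rw [List.append_nil] at hsp
      obtain ⟨s, hs, hst⟩ := hreal
      have h3 : s * t = t⁻¹ * s := by rw [← hst, inv_mul_cancel_right]
      have h4 : (s : CliffordAlgebra Q) * TT Q L = reverse (TT Q L) * s := by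
        have := congrArg (Units.val) h3
        rw [Units.val_mul, Units.val_mul, spin_inv_val ht, hrt, htT, mul_smul_comm,
          smul_mul_assoc] at this
        exact smul_right_injective _ hc0 this
      set τ := prU hfst.2 with hτ
      have h5 : τ * T = T⁻¹ * τ := by ext; exact hflip
      have h6 : s * T = T⁻¹ * s := by ext; exact h4
      have h7 : (τ⁻¹ * s) * T = T * (τ⁻¹ * s) := by
        have h8 : T * τ⁻¹ = τ⁻¹ * T⁻¹ := by
          rw [mul_inv_eq_iff_eq_mul, mul_assoc, ← h5, inv_mul_cancel_left]
        rw [mul_assoc, h6, ← mul_assoc, ← h8, mul_assoc]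
      refine no_odd hL (fun p hp => (hgood p hp).hb) hsp (u := τ⁻¹ * s) ?_ ?_
      · have h9 : reverse (pr Q (L.map Prod.fst)) ∈ evenOdd Q 1 := by
          rw [reverse_mem_evenOdd_iff]
          have := pr_parity (Q := Q) (L.map Prod.fst)
          rwa [List.length_map, (ZMod.natCast_eq_one_iff_odd).2 hodd] at this
        have := evenOdd_mul_le Q _ _ (Submodule.mul_mem_mul h9 hs.2.1)
        rw [add_zero] at this
        exact this
      · exact congrArg Units.val h7
end CL7
end Stmt15

/-- Over an algebraically closed field of characteristic `≠ 2` with `q`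
nondegenerate: if `dim V ≡ 0, 1, 3 (mod 4)` then every element of `Spin(V,q)` is a product
of two elements of `Spin(V,q)` whose squares are `±1`; and (in any dimension) every real
semisimple element of `Spin(V,q)` is a product `τ₁·τ₂` with `τ₁, τ₂ ∈ Spin(V,q)`,
`τ₁² = τ₂² = ±1`. -/
theorem stmt15 {F V : Type*} [Field F] [IsAlgClosed F] [AddCommGroup V] [Module F V]
    [FiniteDimensional F V] (hF2 : (2 : F) ≠ 0) (Q : QuadraticForm F V)
    (hQ : LinearMap.BilinForm.Nondegenerate (QuadraticMap.polarBilin Q)) :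
    ((Module.finrank F V % 4 = 0 ∨ Module.finrank F V % 4 = 1 ∨
        Module.finrank F V % 4 = 3) →
      ∀ t : (CliffordAlgebra Q)ˣ, IsSpinElt Q t →
        ∃ τ₁ τ₂ : (CliffordAlgebra Q)ˣ, IsSpinElt Q τ₁ ∧ IsSpinElt Q τ₂ ∧
          t = τ₁ * τ₂ ∧ (τ₁ ^ 2 = 1 ∨ τ₁ ^ 2 = -1) ∧ (τ₂ ^ 2 = 1 ∨ τ₂ ^ 2 = -1)) ∧
    (∀ t : (CliffordAlgebra Q)ˣ, IsSpinElt Q t →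
      Module.End.IsSemisimple (LinearMap.mulLeft F (t : CliffordAlgebra Q)) →
      (∃ s : (CliffordAlgebra Q)ˣ, IsSpinElt Q s ∧ s * t * s⁻¹ = t⁻¹) →
      ∃ τ₁ τ₂ : (CliffordAlgebra Q)ˣ, IsSpinElt Q τ₁ ∧ IsSpinElt Q τ₂ ∧
        t = τ₁ * τ₂ ∧ τ₁ ^ 2 = τ₂ ^ 2 ∧ (τ₁ ^ 2 = 1 ∨ τ₁ ^ 2 = -1)) := by
  have : NeZero (2 : F) := ⟨hF2⟩
  have hnd : ∀ x, (∀ y, QuadraticMap.polarBilin Q x y = 0) → x = 0 := fun x hx => hQ.1 x hx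
  exact ⟨fun hdim t ht => Stmt15.part1 hnd hdim ht,
    fun t ht hss hreal => Stmt15.part2 hnd ht hss hreal⟩
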